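/- arXiv:1704.01983 — 2 statements merged into one kernel-verified Lean document; each statement's English description precedes it below -/
import Mathlib

section
/- Each of the following graph classes contains a non-efficient graph: (1) bipartite graphs, (2) chordal graphs, (3) planar graphs. In particular, there exist a bipartite graph, a chordal graph (e.g. a sufficiently large complete graph), and a planar graph which, together with suitable terminal placements, contain a Bad Configuration of type BC1a and hence are not efficient. -/
namespace NDG

variable {V : Type*} [DecidableEq V]

/-- Total cost of a finite set of edges. -/
def cost (c : Sym2 V → ℝ) (F : Finset (Sym2 V)) : ℝ := ∑ e ∈ F, c e

/-- A Steiner forest: an acyclic set of edges of `G` connecting both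
terminal pairs. -/
def IsSteinerForest (G : SimpleGraph V) (s₁ t₁ s₂ t₂ : V) (F : Finset (Sym2 V)) : Prop :=
  (↑F ⊆ G.edgeSet) ∧
  (SimpleGraph.fromEdgeSet (↑F : Set (Sym2 V))).IsAcyclic ∧
  (∃ p : G.Walk s₁ t₁, p.IsPath ∧ ∀ e ∈ p.edges, e ∈ F) ∧
  (∃ p : G.Walk s₂ t₂, p.IsPath ∧ ∀ e ∈ p.edges, e ∈ F)

/-- An optimal Steiner forest: one of minimum total cost. -/
def IsOptimalSteinerForest (G : SimpleGraph V) (s₁ t₁ s₂ t₂ : V) (c : Sym2 V → ℝ)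
    (F : Finset (Sym2 V)) : Prop :=
  IsSteinerForest G s₁ t₁ s₂ t₂ F ∧
  ∀ F', IsSteinerForest G s₁ t₁ s₂ t₂ F' → cost c F ≤ cost c F'

/-- A strategy of a player: a simple path between her terminals. -/
abbrev Strat (G : SimpleGraph V) (s t : V) := {p : G.Walk s t // p.IsPath}

/-- A cost sharing protocol: cost shares for both players on every edge,
depending on the chosen strategy profile. -/
abbrev Protocol (G : SimpleGraph V) (s₁ t₁ s₂ t₂ : V) :=
  Strat G s₁ t₁ → Strat G s₂ t₂ → Fin 2 → Sym2 V → ℝ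

/-- The set of players using edge `e` in the profile `(P₁, P₂)`. -/
def usedBy {G : SimpleGraph V} {s₁ t₁ s₂ t₂ : V}
    (P₁ : Strat G s₁ t₁) (P₂ : Strat G s₂ t₂) (e : Sym2 V) : Finset (Fin 2) :=
  (if e ∈ P₁.1.edges then {0} else ∅) ∪ (if e ∈ P₂.1.edges then {1} else ∅)

/-- The total cost player 1 pays. -/
def cost₁ {G : SimpleGraph V} {s₁ t₁ s₂ t₂ : V} (Ξ : Protocol G s₁ t₁ s₂ t₂)
    (P₁ : Strat G s₁ t₁) (P₂ : Strat G s₂ t₂) : ℝ :=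
  ∑ e ∈ P₁.1.edges.toFinset, Ξ P₁ P₂ 0 e

/-- The total cost player 2 pays. -/
def cost₂ {G : SimpleGraph V} {s₁ t₁ s₂ t₂ : V} (Ξ : Protocol G s₁ t₁ s₂ t₂)
    (P₁ : Strat G s₁ t₁) (P₂ : Strat G s₂ t₂) : ℝ :=
  ∑ e ∈ P₂.1.edges.toFinset, Ξ P₁ P₂ 1 e

/-- Pure Nash equilibrium of the two-player game induced by the protocol `Ξ`. -/
def IsPNE {G : SimpleGraph V} {s₁ t₁ s₂ t₂ : V} (Ξ : Protocol G s₁ t₁ s₂ t₂)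
    (P₁ : Strat G s₁ t₁) (P₂ : Strat G s₂ t₂) : Prop :=
  (∀ Q₁, cost₁ Ξ P₁ P₂ ≤ cost₁ Ξ Q₁ P₂) ∧ (∀ Q₂, cost₂ Ξ P₁ P₂ ≤ cost₂ Ξ P₁ Q₂)

/-- A separable cost sharing protocol: nonnegative, budget-balanced, stable and
separable (cost shares on an edge depend only on the set of players using it). -/
structure IsSeparable {G : SimpleGraph V} {s₁ t₁ s₂ t₂ : V} (c : Sym2 V → ℝ)
    (Ξ : Protocol G s₁ t₁ s₂ t₂) : Prop where
  nonneg : ∀ P₁ P₂ i e, 0 ≤ Ξ P₁ P₂ i e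
  budget : ∀ P₁ P₂ e, (usedBy P₁ P₂ e).Nonempty →
    ∑ i ∈ usedBy P₁ P₂ e, Ξ P₁ P₂ i e = c e
  stable : ∃ P₁ P₂, IsPNE Ξ P₁ P₂
  separable : ∀ P₁ P₂ Q₁ Q₂ e, usedBy P₁ P₂ e = usedBy Q₁ Q₂ e →
    ∀ i, Ξ P₁ P₂ i e = Ξ Q₁ Q₂ i e

/-- A Steiner forest `F` is enforceable if the profile of the unique paths of
the two players inside `F` is a pure Nash equilibrium of the game induced by
some separable cost sharing protocol. -/
def Enforceable (G : SimpleGraph V) (s₁ t₁ s₂ t₂ : V) (c : Sym2 V → ℝ)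
    (F : Finset (Sym2 V)) : Prop :=
  ∃ (P₁ : Strat G s₁ t₁) (P₂ : Strat G s₂ t₂),
    (∀ e ∈ P₁.1.edges, e ∈ F) ∧ (∀ e ∈ P₂.1.edges, e ∈ F) ∧
    (∀ Q₁ : Strat G s₁ t₁, (∀ e ∈ Q₁.1.edges, e ∈ F) → Q₁ = P₁) ∧
    (∀ Q₂ : Strat G s₂ t₂, (∀ e ∈ Q₂.1.edges, e ∈ F) → Q₂ = P₂) ∧
    ∃ Ξ : Protocol G s₁ t₁ s₂ t₂, IsSeparable c Ξ ∧ IsPNE Ξ P₁ P₂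

/-- `(G,(s₁,t₁),(s₂,t₂))` is efficient: for every nonnegative cost function
some optimal Steiner forest is enforceable (the PoS is 1). -/
def Efficient (G : SimpleGraph V) (s₁ t₁ s₂ t₂ : V) : Prop :=
  ∀ c : Sym2 V → ℝ, (∀ e, 0 ≤ c e) →
    ∃ F, IsOptimalSteinerForest G s₁ t₁ s₂ t₂ c F ∧ Enforceable G s₁ t₁ s₂ t₂ c F

/-- `(G,(s₁,t₁),(s₂,t₂))` is strongly efficient: for every nonnegative cost
function every optimal Steiner forest is enforceable. -/
def StronglyEfficient (G : SimpleGraph V) (s₁ t₁ s₂ t₂ : V) : Prop :=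
  ∀ c : Sym2 V → ℝ, (∀ e, 0 ≤ c e) →
    ∀ F, IsOptimalSteinerForest G s₁ t₁ s₂ t₂ c F → Enforceable G s₁ t₁ s₂ t₂ c F

/-- A preliminary bad configuration (PBC) for the terminal pairs `(u,v)` and
`(w,x)`: the path `P_u = Lu ++ M ++ Ru` of one player and the path
`P_ℓ = Ll ++ M ++ Rl` of the other player meet exactly in the nonempty,
consistently oriented common subpath `M`; `q₁` closes a unique cycle with `P_u`
(intersecting it in the segment `S1`, which contains edges of `R_u` and of `M`),
`q₂` and `q₃` close unique cycles with `P_ℓ` (intersecting it in the segments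
`S2` resp. `S3`, containing edges of `L_ℓ` resp. `R_ℓ` and of `M`, and missing
part of `M`); moreover `C := C₂ ∩ C₃ ∩ M` is nonempty and contained in `C₁`, and
`(M ∩ C₁ ∩ C₂) \ C` and `(M ∩ C₁ ∩ C₃) \ C` each contain an edge. -/
structure PBC (G : SimpleGraph V) (u v w x : V) where
  a : V
  b : V
  Lu : G.Walk u a
  M : G.Walk a b
  Ru : G.Walk b v
  Ll : G.Walk w a
  Rl : G.Walk b x
  hM_ne : M.edges ≠ []
  hPu : ((Lu.append M).append Ru).IsPath
  hPl : ((Ll.append M).append Rl).IsPath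
  hforest : (SimpleGraph.fromEdgeSet
      {e | e ∈ ((Lu.append M).append Ru).edges ∨ e ∈ ((Ll.append M).append Rl).edges}).IsAcyclic
  hmeet : ∀ e, e ∈ ((Lu.append M).append Ru).edges →
      e ∈ ((Ll.append M).append Rl).edges → e ∈ M.edges
  hRu_ne : Ru.edges ≠ []
  hLl_ne : Ll.edges ≠ []
  hRl_ne : Rl.edges ≠ []
  a1 : V
  b1 : V
  q1 : G.Walk a1 b1
  S1 : G.Walk a1 b1
  hq1path : q1.IsPath
  hq1_ne : q1.edges ≠ []
  hS1 : S1.darts <:+: ((Lu.append M).append Ru).darts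
  hq1closes : ∀ y ∈ q1.support, y ∈ ((Lu.append M).append Ru).support → y = a1 ∨ y = b1
  hC1Ru : ∃ e ∈ S1.edges, e ∈ Ru.edges
  hC1M : ∃ e ∈ S1.edges, e ∈ M.edges
  a2 : V
  b2 : V
  q2 : G.Walk a2 b2
  S2 : G.Walk a2 b2
  hq2path : q2.IsPath
  hq2_ne : q2.edges ≠ []
  hS2 : S2.darts <:+: ((Ll.append M).append Rl).darts
  hq2closes : ∀ y ∈ q2.support, y ∈ ((Ll.append M).append Rl).support → y = a2 ∨ y = b2
  hC2Ll : ∃ e ∈ S2.edges, e ∈ Ll.edges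
  hC2M : ∃ e ∈ S2.edges, e ∈ M.edges
  hMC2 : ∃ e ∈ M.edges, e ∉ S2.edges
  a3 : V
  b3 : V
  q3 : G.Walk a3 b3
  S3 : G.Walk a3 b3
  hq3path : q3.IsPath
  hq3_ne : q3.edges ≠ []
  hS3 : S3.darts <:+: ((Ll.append M).append Rl).darts
  hq3closes : ∀ y ∈ q3.support, y ∈ ((Ll.append M).append Rl).support → y = a3 ∨ y = b3
  hC3Rl : ∃ e ∈ S3.edges, e ∈ Rl.edges
  hC3M : ∃ e ∈ S3.edges, e ∈ M.edges
  hMC3 : ∃ e ∈ M.edges, e ∉ S3.edges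
  hC_ne : ∃ e ∈ M.edges, e ∈ S2.edges ∧ e ∈ S3.edges
  hC_sub : ∀ e ∈ M.edges, e ∈ S2.edges → e ∈ S3.edges → e ∈ S1.edges
  hC1C2 : ∃ e ∈ M.edges, e ∈ S1.edges ∧ e ∈ S2.edges ∧ e ∉ S3.edges
  hC1C3 : ∃ e ∈ M.edges, e ∈ S1.edges ∧ e ∈ S3.edges ∧ e ∉ S2.edges

namespace PBC

variable {G : SimpleGraph V} {u v w x : V}

/-- The path of the "upper" player (terminals `u`, `v`). -/
def Pu (B : PBC G u v w x) : G.Walk u v := (B.Lu.append B.M).append B.Ru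

/-- The path of the "lower" player (terminals `w`, `x`). -/
def Pl (B : PBC G u v w x) : G.Walk w x := (B.Ll.append B.M).append B.Rl

/-- `q₁` is small: the cycle `C₁` contains no edge of `L_u`. -/
def Small (B : PBC G u v w x) : Prop := ∀ e ∈ B.S1.edges, e ∉ B.Lu.edges

/-- `q₁` is big: the cycle `C₁` contains an edge of `L_u`. -/
def Big (B : PBC G u v w x) : Prop := ∃ e ∈ B.S1.edges, e ∈ B.Lu.edges

/-- Node-disjointness of two walks. -/
def NodeDisj {y z y' z' : V} (p : G.Walk y z) (q : G.Walk y' z') : Prop :=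
  ∀ s ∈ p.support, s ∉ q.support

/-- `q` is internally node-disjoint from `P_u ∪ P_ℓ`. -/
def InternDisj (B : PBC G u v w x) {y z : V} (q : G.Walk y z) : Prop :=
  ∀ s ∈ q.support, s ≠ y → s ≠ z → s ∉ B.Pu.support ∧ s ∉ B.Pl.support

/-- The two walks intersect exactly in a common (possibly reversed) subpath. -/
def CommonMid {y z y' z' : V} (p : G.Walk y z) (q : G.Walk y' z') : Prop :=
  ∃ (c d : V) (m : G.Walk c d), m.IsPath ∧
    m.darts <:+: p.darts ∧ (m.darts <:+: q.darts ∨ m.reverse.darts <:+: q.darts) ∧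
    ∀ s, s ∈ p.support → s ∈ q.support → s ∈ m.support

/-- `q` contains no node of `L_u` or `R_u`. -/
def AvoidsUpperOuter (B : PBC G u v w x) {y z : V} (q : G.Walk y z) : Prop :=
  ∀ s ∈ q.support, s ∉ B.Lu.support ∧ s ∉ B.Ru.support

/-- In BC3/BC4, `q₁` avoids `R_ℓ` and the start node of `q₂`, and its initial
segment `α₁` (up to the last node contained in `L_ℓ`) runs inside the cycle
`C₂` along `L_ℓ`. -/
def LlTraverse (B : PBC G u v w x) : Prop :=
  (∀ s ∈ B.q1.support, s ∉ B.Rl.support) ∧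
  B.a2 ∉ B.q1.support ∧
  ∃ (y : V) (α : G.Walk B.a1 y) (β : G.Walk y B.b1),
    B.q1 = α.append β ∧ y ∈ B.Ll.support ∧
    (∀ e ∈ α.edges, e ∈ B.S2.edges) ∧
    (∀ s ∈ β.support, s ∈ B.Ll.support → s = y)

/-- Types BC1a (`q₁` small) and BC1b (`q₁` big): `q₁,q₂,q₃` pairwise
node-disjoint and internally node-disjoint from `P_u ∪ P_ℓ`. -/
def BC1 (B : PBC G u v w x) : Prop :=
  NodeDisj B.q1 B.q2 ∧ NodeDisj B.q1 B.q3 ∧ NodeDisj B.q2 B.q3 ∧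
  B.InternDisj B.q1 ∧ B.InternDisj B.q2 ∧ B.InternDisj B.q3

/-- Types BC2a–d: `q₃` node-disjoint with `q₁` and `q₂`; `q₁` and `q₂` overlap
exactly in a common subpath (`α₂ = β₂`); everything internally node-disjoint
from `P_u ∪ P_ℓ` (the subtypes corresponding to `q₁` small/big and the two
orientations of the common subpath are subsumed). -/
def BC2 (B : PBC G u v w x) : Prop :=
  NodeDisj B.q3 B.q1 ∧ NodeDisj B.q3 B.q2 ∧
  ¬ NodeDisj B.q1 B.q2 ∧ CommonMid B.q1 B.q2 ∧
  B.InternDisj B.q1 ∧ B.InternDisj B.q2 ∧ B.InternDisj B.q3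

/-- Type BC3. -/
def BC3 (B : PBC G u v w x) : Prop :=
  B.Small ∧ (∀ e ∈ B.M.edges, e ∈ B.S1.edges) ∧
  NodeDisj B.q1 B.q2 ∧ NodeDisj B.q1 B.q3 ∧ NodeDisj B.q2 B.q3 ∧
  B.AvoidsUpperOuter B.q2 ∧ B.AvoidsUpperOuter B.q3 ∧
  B.LlTraverse

/-- Types BC4a/b. -/
def BC4 (B : PBC G u v w x) : Prop :=
  B.Small ∧ (∀ e ∈ B.M.edges, e ∈ B.S1.edges) ∧
  NodeDisj B.q3 B.q1 ∧ NodeDisj B.q3 B.q2 ∧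
  ¬ NodeDisj B.q1 B.q2 ∧ CommonMid B.q1 B.q2 ∧
  B.AvoidsUpperOuter B.q2 ∧ B.AvoidsUpperOuter B.q3 ∧
  B.LlTraverse

/-- A PBC is a bad configuration if it is of one of the nine types
BC1a, BC1b, BC2a, BC2b, BC2c, BC2d, BC3, BC4a, BC4b. -/
def IsBC (B : PBC G u v w x) : Prop := B.BC1 ∨ B.BC2 ∨ B.BC3 ∨ B.BC4

end PBC

/-- `(G,(s₁,t₁),(s₂,t₂))` contains a subgraph which is a bad configuration,
for some assignment of the terminal pairs to `(u,v)` and `(w,x)`. -/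
def ContainsBC (G : SimpleGraph V) (s₁ t₁ s₂ t₂ : V) : Prop :=
  (∃ B : PBC G s₁ t₁ s₂ t₂, B.IsBC) ∨ (∃ B : PBC G s₁ t₁ t₂ s₂, B.IsBC) ∨
  (∃ B : PBC G t₁ s₁ s₂ t₂, B.IsBC) ∨ (∃ B : PBC G t₁ s₁ t₂ s₂, B.IsBC) ∨
  (∃ B : PBC G s₂ t₂ s₁ t₁, B.IsBC) ∨ (∃ B : PBC G s₂ t₂ t₁ s₁, B.IsBC) ∨
  (∃ B : PBC G t₂ s₂ s₁ t₁, B.IsBC) ∨ (∃ B : PBC G t₂ s₂ t₁ s₁, B.IsBC)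


/-- `(G,(s₁,t₁),(s₂,t₂))` contains a subgraph which is a bad configuration of
type BC1a: a PBC with `q₁` small, `q₁, q₂, q₃` pairwise node-disjoint and
internally node-disjoint from `P_u ∪ P_ℓ` (for some assignment of the terminal
pairs to `(u,v)` and `(w,x)`). -/
def ContainsBC1a (G : SimpleGraph V) (s₁ t₁ s₂ t₂ : V) : Prop :=
  (∃ B : PBC G s₁ t₁ s₂ t₂, B.BC1 ∧ B.Small) ∨ (∃ B : PBC G s₁ t₁ t₂ s₂, B.BC1 ∧ B.Small) ∨
  (∃ B : PBC G t₁ s₁ s₂ t₂, B.BC1 ∧ B.Small) ∨ (∃ B : PBC G t₁ s₁ t₂ s₂, B.BC1 ∧ B.Small) ∨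
  (∃ B : PBC G s₂ t₂ s₁ t₁, B.BC1 ∧ B.Small) ∨ (∃ B : PBC G s₂ t₂ t₁ s₁, B.BC1 ∧ B.Small) ∨
  (∃ B : PBC G t₂ s₂ s₁ t₁, B.BC1 ∧ B.Small) ∨ (∃ B : PBC G t₂ s₂ t₁ s₁, B.BC1 ∧ B.Small)

/-- A chordal graph: every cycle of length at least 4 has a chord. -/
def Chordal (G : SimpleGraph V) : Prop :=
  ∀ (y : V) (p : G.Walk y y), p.IsCycle → 4 ≤ p.length →
    ∃ c d : V, c ∈ p.support ∧ d ∈ p.support ∧ G.Adj c d ∧ s(c, d) ∉ p.edges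

/-- `H` has a `K k` minor (branch-set formulation). -/
def HasCliqueMinor (H : SimpleGraph V) (k : ℕ) : Prop :=
  ∃ S : Fin k → Set V, (∀ i, (S i).Nonempty) ∧
    (∀ i, (H.induce (S i)).Connected) ∧
    (∀ i j, i ≠ j → Disjoint (S i) (S j)) ∧
    (∀ i j, i ≠ j → ∃ p ∈ S i, ∃ q ∈ S j, H.Adj p q)

/-- `H` has a `K₃,₃` minor (branch-set formulation). -/
def HasK33Minor (H : SimpleGraph V) : Prop :=
  ∃ S T : Fin 3 → Set V, (∀ i, (S i).Nonempty) ∧ (∀ i, (T i).Nonempty) ∧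
    (∀ i, (H.induce (S i)).Connected) ∧ (∀ i, (H.induce (T i)).Connected) ∧
    (∀ i j, i ≠ j → Disjoint (S i) (S j)) ∧ (∀ i j, i ≠ j → Disjoint (T i) (T j)) ∧
    (∀ i j, Disjoint (S i) (T j)) ∧
    (∀ i j, ∃ p ∈ S i, ∃ q ∈ T j, H.Adj p q)

/-- A planar graph, via Wagner's characterization: no `K₅` minor and no
`K₃,₃` minor. -/
def Planar (H : SimpleGraph V) : Prop := ¬ HasCliqueMinor H 5 ∧ ¬ HasK33Minor H

end NDG

namespace NDG

open SimpleGraph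

/-- The ten edges of the base graph. -/
def E8 : Finset (Sym2 (Fin 8)) :=
  {s(0,1), s(1,2), s(2,3), s(3,4), s(0,5), s(4,5), s(0,6), s(3,7), s(2,6), s(1,7)}

/-- The six edges of the optimal forest. -/
def F0 : Finset (Sym2 (Fin 8)) :=
  {s(0,1), s(1,2), s(2,3), s(3,4), s(0,6), s(3,7)}

/-- Integer edge costs. -/
def cN (e : Sym2 (Fin 8)) : ℕ :=
  if e = s(0,1) then 4 else if e = s(1,2) then 4 else if e = s(2,3) then 4
  else if e = s(3,4) then 10 else if e = s(0,5) then 8 else if e = s(4,5) then 9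
  else if e = s(0,6) then 10 else if e = s(3,7) then 10 else if e = s(2,6) then 12
  else if e = s(1,7) then 12 else 1000

/-- The side of `a` after deleting the edge `ab` of the forest `F0`. -/
def side (e : Sym2 (Fin 8)) : Finset (Fin 8) :=
  if e = s(0,1) then {1,2,3,4,7} else if e = s(1,2) then {2,3,4,7}
  else if e = s(2,3) then {3,4,7} else if e = s(3,4) then {4}
  else if e = s(0,6) then {6} else {7}

lemma side_spec : ∀ v w : Fin 8, s(v,w) ∈ F0 → (v ∈ side s(v,w) ↔ w ∉ side s(v,w)) ∧
    ∀ a b : Fin 8, s(a,b) ∈ F0 → a ∈ side s(v,w) → b ∉ side s(v,w) → s(a,b) = s(v,w) := by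
  decide +kernel

lemma F0_acyclic : (fromEdgeSet (↑F0 : Set (Sym2 (Fin 8)))).IsAcyclic := by
  have key : ∀ v w : Fin 8, s(v,w) ∈ F0 → v ∈ side s(v,w) →
      ∀ p : (fromEdgeSet (↑F0 : Set (Sym2 (Fin 8)))).Walk v w, s(v,w) ∈ p.edges := by
    intro v w hvw hv p
    obtain ⟨h1, h2⟩ := side_spec v w hvw
    obtain ⟨d, hd, ha, hb⟩ := p.exists_boundary_dart (↑(side s(v,w)) : Set (Fin 8))
      (by simpa using hv) (by simpa using h1.1 hv)
    have hadj := d.adj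
    rw [fromEdgeSet_adj] at hadj
    have := h2 d.fst d.snd (by simpa using hadj.1) (by simpa using ha) (by simpa using hb)
    rw [← this]
    exact List.mem_map.2 ⟨d, hd, rfl⟩
  rw [isAcyclic_iff_forall_adj_isBridge]
  intro v w hvw
  rw [fromEdgeSet_adj] at hvw
  have hF : s(v,w) ∈ F0 := by simpa using hvw.1
  rw [isBridge_iff_forall_walk_mem_edges]
  intro p
  by_cases hv : v ∈ side s(v,w)
  · exact key v w hF hv p
  · have hF' : s(w,v) ∈ F0 := by rwa [Sym2.eq_swap]
    have hs : s(w,v) = s(v,w) := Sym2.eq_swap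
    have hw : w ∈ side s(w,v) := by
      rw [hs]
      by_contra hw
      exact hv ((side_spec v w hF).1.2 hw)
    have := key w v hF' hw p.reverse
    rw [hs, Walk.edges_reverse, List.mem_reverse] at this
    exact this

section generic

variable {G : SimpleGraph (Fin 8)}

lemma adjOf (hG : ∀ e ∈ E8, e ∈ G.edgeSet) (a b : Fin 8) (h : s(a,b) ∈ E8) : G.Adj a b :=
  hG _ h

/-- The middle path. -/
def wM (hG : ∀ e ∈ E8, e ∈ G.edgeSet) : G.Walk 0 3 :=
  .cons (adjOf hG 0 1 (by decide)) (.cons (adjOf hG 1 2 (by decide))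
    (.cons (adjOf hG 2 3 (by decide)) .nil))

/-- One-edge walk. -/
def wE (hG : ∀ e ∈ E8, e ∈ G.edgeSet) (a b : Fin 8) (h : s(a,b) ∈ E8) : G.Walk a b :=
  .cons (adjOf hG a b h) .nil

/-- The upper path. -/
def wPu (hG : ∀ e ∈ E8, e ∈ G.edgeSet) : G.Walk 0 4 :=
  .cons (adjOf hG 0 1 (by decide)) (.cons (adjOf hG 1 2 (by decide))
    (.cons (adjOf hG 2 3 (by decide)) (wE hG 3 4 (by decide))))

/-- The lower path. -/
def wPl (hG : ∀ e ∈ E8, e ∈ G.edgeSet) : G.Walk 6 7 :=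
  .cons (adjOf hG 6 0 (by decide)) (.cons (adjOf hG 0 1 (by decide))
    (.cons (adjOf hG 1 2 (by decide))
    (.cons (adjOf hG 2 3 (by decide)) (wE hG 3 7 (by decide)))))

/-- The deviation of the upper player. -/
def wQ1 (hG : ∀ e ∈ E8, e ∈ G.edgeSet) : G.Walk 0 4 :=
  .cons (adjOf hG 0 5 (by decide)) (wE hG 5 4 (by decide))

/-- First deviation of the lower player. -/
def wQ2 (hG : ∀ e ∈ E8, e ∈ G.edgeSet) : G.Walk 6 7 :=
  .cons (adjOf hG 6 2 (by decide)) (.cons (adjOf hG 2 3 (by decide)) (wE hG 3 7 (by decide)))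

/-- Second deviation of the lower player. -/
def wQ3 (hG : ∀ e ∈ E8, e ∈ G.edgeSet) : G.Walk 6 7 :=
  .cons (adjOf hG 6 0 (by decide)) (.cons (adjOf hG 0 1 (by decide)) (wE hG 1 7 (by decide)))

/-- The segment closed by `q₂`. -/
def wS2 (hG : ∀ e ∈ E8, e ∈ G.edgeSet) : G.Walk 6 2 :=
  .cons (adjOf hG 6 0 (by decide)) (.cons (adjOf hG 0 1 (by decide)) (wE hG 1 2 (by decide)))

/-- The segment closed by `q₃`. -/
def wS3 (hG : ∀ e ∈ E8, e ∈ G.edgeSet) : G.Walk 1 7 :=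
  .cons (adjOf hG 1 2 (by decide)) (.cons (adjOf hG 2 3 (by decide)) (wE hG 3 7 (by decide)))

lemma isPath_of_support {a b : Fin 8} (p : G.Walk a b) (l : List (Fin 8)) (h : p.support = l)
    (hl : l.Nodup) : p.IsPath := by
  rw [Walk.isPath_def, h]; exact hl

/-- The bad configuration. -/
def thePBC (hG : ∀ e ∈ E8, e ∈ G.edgeSet) : PBC G 0 4 6 7 where
  a := 0
  b := 3
  Lu := .nil
  M := wM hG
  Ru := wE hG 3 4 (by decide)
  Ll := wE hG 6 0 (by decide)
  Rl := wE hG 3 7 (by decide)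
  hM_ne := by simp [wM]
  hPu := isPath_of_support _ [0,1,2,3,4] rfl (by decide)
  hPl := isPath_of_support _ [6,0,1,2,3,7] rfl (by decide)
  hforest := by
    refine F0_acyclic.anti (fromEdgeSet_mono ?_)
    have : ∀ e, e ∈ [s((0 : Fin 8),1), s(1,2), s(2,3), s(3,4)] ∨
      e ∈ [s((6 : Fin 8),0), s(0,1), s(1,2), s(2,3), s(3,7)] → e ∈ F0 := by decide
    exact this
  hmeet := by
    have : ∀ e, e ∈ [s((0 : Fin 8),1), s(1,2), s(2,3), s(3,4)] →
      e ∈ [s((6 : Fin 8),0), s(0,1), s(1,2), s(2,3), s(3,7)] →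
      e ∈ [s((0 : Fin 8),1), s(1,2), s(2,3)] := by decide
    exact this
  hRu_ne := by simp [wE]
  hLl_ne := by simp [wE]
  hRl_ne := by simp [wE]
  a1 := 0
  b1 := 4
  q1 := wQ1 hG
  S1 := wPu hG
  hq1path := isPath_of_support _ [0,5,4] rfl (by decide)
  hq1_ne := by simp [wQ1]
  hS1 := ⟨[], [], rfl⟩
  hq1closes := by
    have : ∀ y ∈ [(0 : Fin 8),5,4], y ∈ [(0 : Fin 8),1,2,3,4] → y = 0 ∨ y = 4 := by decide
    exact this
  hC1Ru := ⟨s(3,4), by simp [wPu, wE], by simp [wE]⟩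
  hC1M := ⟨s(0,1), by simp [wPu, wE], by simp [wM]⟩
  a2 := 6
  b2 := 2
  q2 := wE hG 6 2 (by decide)
  S2 := wS2 hG
  hq2path := isPath_of_support _ [6,2] rfl (by decide)
  hq2_ne := by simp [wE]
  hS2 := ⟨[], (wE hG 2 3 (by decide)).darts ++ (wE hG 3 7 (by decide)).darts, rfl⟩
  hq2closes := by
    have : ∀ y ∈ [(6 : Fin 8),2], y ∈ [(6 : Fin 8),0,1,2,3,7] → y = 6 ∨ y = 2 := by decide
    exact this
  hC2Ll := ⟨s(6,0), by simp [wS2, wE], by simp [wE]⟩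
  hC2M := ⟨s(0,1), by simp [wS2, wE], by simp [wM]⟩
  hMC2 := ⟨s(2,3), by simp [wM], by simp [wS2, wE]⟩
  a3 := 1
  b3 := 7
  q3 := wE hG 1 7 (by decide)
  S3 := wS3 hG
  hq3path := isPath_of_support _ [1,7] rfl (by decide)
  hq3_ne := by simp [wE]
  hS3 := ⟨(wE hG 6 0 (by decide)).darts ++ (wE hG 0 1 (by decide)).darts, [], rfl⟩
  hq3closes := by
    have : ∀ y ∈ [(1 : Fin 8),7], y ∈ [(6 : Fin 8),0,1,2,3,7] → y = 1 ∨ y = 7 := by decide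
    exact this
  hC3Rl := ⟨s(3,7), by simp [wS3, wE], by simp [wE]⟩
  hC3M := ⟨s(1,2), by simp [wS3, wE], by simp [wM]⟩
  hMC3 := ⟨s(0,1), by simp [wM], by simp [wS3, wE]⟩
  hC_ne := ⟨s(1,2), by simp [wM], by simp [wS2, wE], by simp [wS3]⟩
  hC_sub := by
    intro e he _ _
    have : ∀ e ∈ [s((0 : Fin 8),1), s(1,2), s(2,3)],
      e ∈ [s((0 : Fin 8),1), s(1,2), s(2,3), s(3,4)] := by decide
    exact this e he
  hC1C2 := ⟨s(0,1), by simp [wM], by simp [wPu], by simp [wS2], by simp [wS3, wE]⟩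
  hC1C3 := ⟨s(2,3), by simp [wM], by simp [wPu], by simp [wS3], by simp [wS2, wE]⟩

lemma containsBC1a (hG : ∀ e ∈ E8, e ∈ G.edgeSet) : ContainsBC1a G 0 4 6 7 := by
  refine Or.inl ⟨thePBC hG, ⟨?_, ?_, ?_, ?_, ?_, ?_⟩, ?_⟩
  · have : ∀ s ∈ [(0 : Fin 8),5,4], s ∉ [(6 : Fin 8),2] := by decide
    exact this
  · have : ∀ s ∈ [(0 : Fin 8),5,4], s ∉ [(1 : Fin 8),7] := by decide
    exact this
  · have : ∀ s ∈ [(6 : Fin 8),2], s ∉ [(1 : Fin 8),7] := by decide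
    exact this
  · have : ∀ s ∈ [(0 : Fin 8),5,4], s ≠ 0 → s ≠ 4 → s ∉ [(0 : Fin 8),1,2,3,4] ∧
      s ∉ [(6 : Fin 8),0,1,2,3,7] := by decide
    exact this
  · have : ∀ s ∈ [(6 : Fin 8),2], s ≠ 6 → s ≠ 2 → s ∉ [(0 : Fin 8),1,2,3,4] ∧
      s ∉ [(6 : Fin 8),0,1,2,3,7] := by decide
    exact this
  · have : ∀ s ∈ [(1 : Fin 8),7], s ≠ 1 → s ≠ 7 → s ∉ [(0 : Fin 8),1,2,3,4] ∧
      s ∉ [(6 : Fin 8),0,1,2,3,7] := by decide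
    exact this
  · intro e _ he
    exact absurd he (by simp [thePBC])

lemma cut {F : Finset (Sym2 (Fin 8))} (hF : F ⊆ E8) {s t : Fin 8} (p : G.Walk s t)
    (hp : ∀ e ∈ p.edges, e ∈ F) (S : Finset (Fin 8)) (K : Finset (Sym2 (Fin 8)))
    (hs : s ∈ S) (ht : t ∉ S)
    (hK : ∀ a ∈ S, ∀ b, b ∉ S → s(a,b) ∈ E8 → s(a,b) ∈ K) : ∃ e ∈ K, e ∈ F := by
  obtain ⟨d, hd, ha, hb⟩ := p.exists_boundary_dart (↑S : Set (Fin 8))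
      (by simpa using hs) (by simpa using ht)
  have h1 : s(d.fst, d.snd) ∈ F := hp _ (List.mem_map.2 ⟨d, hd, rfl⟩)
  exact ⟨_, hK _ (by simpa using ha) _ (by simpa using hb) (hF h1), h1⟩

lemma bits : ∀ b0 b1 b2 b3 b4 b5 b6 b7 b8 b9 : Bool,
    ((if b0 then 4 else 0) + ((if b1 then 4 else 0) + ((if b2 then 4 else 0) +
    ((if b3 then 10 else 0) + ((if b4 then 8 else 0) + ((if b5 then 9 else 0) +
    ((if b6 then 10 else 0) + ((if b7 then 10 else 0) + ((if b8 then 12 else 0) +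
    (if b9 then 12 else 0))))))))) ≤ 42) →
    (b6 || b8) → (b7 || b9) → (b3 || b5) → (b3 || b4) → (b0 || b5 || b8) →
    (b0 || b5 || b6) → (b2 || b4 || b9) → (b2 || b4 || b7) → (b0 || b3 || b8) →
    (b1 || b5 || b8 || b9) → (b1 || b2 || b6) → (b1 || b4 || b6 || b9) →
    (b1 || b4 || b6 || b7) → (b1 || b4 || b7 || b8) → (b1 || b3 || b8 || b9) →
    (b0 && b1 && b2 && b3 && b6 && b7) := by
  decide +kernel

lemma cN_out : ∀ e : Sym2 (Fin 8), e ∉ E8 → cN e = 1000 := by decide +kernel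

lemma F0_sub {F : Finset (Sym2 (Fin 8))} (hc : ∑ e ∈ F, cN e ≤ 42)
    (p : G.Walk 0 4) (hp : ∀ e ∈ p.edges, e ∈ F)
    (q : G.Walk 6 7) (hq : ∀ e ∈ q.edges, e ∈ F) : F0 ⊆ F := by
  have hF : F ⊆ E8 := by
    intro e he
    by_contra hn
    have h1 : cN e ≤ ∑ e ∈ F, cN e := Finset.single_le_sum (fun _ _ => Nat.zero_le _) he
    have := cN_out e hn
    omega
  have hsum : ∑ e ∈ E8, (if e ∈ F then cN e else 0) ≤ 42 := by
    rw [← Finset.sum_filter, Finset.filter_mem_eq_inter, Finset.inter_eq_right.2 hF]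
    exact hc
  have c1 := cut hF q hq {6} {s(0,6), s(2,6)} (by decide) (by decide) (by decide)
  have c2 := cut hF q hq {0,1,2,3,4,5,6} {s(3,7), s(1,7)} (by decide) (by decide) (by decide)
  have c3 := cut hF p hp {0,1,2,3,5,6,7} {s(3,4), s(4,5)} (by decide) (by decide) (by decide)
  have c4 := cut hF p hp {0,1,2,3,6,7} {s(3,4), s(0,5)} (by decide) (by decide) (by decide)
  have c5 := cut hF p hp {0,5,6} {s(0,1), s(4,5), s(2,6)} (by decide) (by decide) (by decide)
  have c6 := cut hF p hp {0,5} {s(0,1), s(4,5), s(0,6)} (by decide) (by decide) (by decide)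
  have c7 := cut hF p hp {0,1,2,6} {s(2,3), s(0,5), s(1,7)} (by decide) (by decide) (by decide)
  have c8 := cut hF p hp {0,1,2,6,7} {s(2,3), s(0,5), s(3,7)} (by decide) (by decide) (by decide)
  have c9 := cut hF q hq {0,4,5,6} {s(0,1), s(3,4), s(2,6)} (by decide) (by decide) (by decide)
  have c10 := cut hF p hp {0,1,5,6} {s(1,2), s(4,5), s(2,6), s(1,7)}
    (by decide) (by decide) (by decide)
  have c11 := cut hF q hq {2,6} {s(1,2), s(2,3), s(0,6)} (by decide) (by decide) (by decide)
  have c12 := cut hF p hp {0,1} {s(1,2), s(0,5), s(0,6), s(1,7)}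
    (by decide) (by decide) (by decide)
  have c13 := cut hF p hp {0,1,7} {s(1,2), s(0,5), s(0,6), s(3,7)}
    (by decide) (by decide) (by decide)
  have c14 := cut hF p hp {0,1,6,7} {s(1,2), s(0,5), s(3,7), s(2,6)}
    (by decide) (by decide) (by decide)
  have c15 := cut hF q hq {0,1,4,5,6} {s(1,2), s(3,4), s(2,6), s(1,7)}
    (by decide) (by decide) (by decide)
  have B := bits (decide (s(0,1) ∈ F)) (decide (s(1,2) ∈ F)) (decide (s(2,3) ∈ F))
    (decide (s(3,4) ∈ F)) (decide (s(0,5) ∈ F)) (decide (s(4,5) ∈ F)) (decide (s(0,6) ∈ F))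
    (decide (s(3,7) ∈ F)) (decide (s(2,6) ∈ F)) (decide (s(1,7) ∈ F))
  have hE : ∑ e ∈ E8, (if e ∈ F then cN e else 0) =
    (if s(0,1) ∈ F then 4 else 0) + ((if s(1,2) ∈ F then 4 else 0) +
    ((if s(2,3) ∈ F then 4 else 0) + ((if s(3,4) ∈ F then 10 else 0) +
    ((if s(0,5) ∈ F then 8 else 0) + ((if s(4,5) ∈ F then 9 else 0) +
    ((if s(0,6) ∈ F then 10 else 0) + ((if s(3,7) ∈ F then 10 else 0) +
    ((if s(2,6) ∈ F then 12 else 0) + (if s(1,7) ∈ F then 12 else 0))))))))) := by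
    unfold E8
    repeat rw [Finset.sum_insert (by decide)]
    rw [Finset.sum_singleton]
    rfl
  rw [hE] at hsum
  simp only [Finset.mem_insert, Finset.mem_singleton, exists_eq_or_imp, exists_eq_left] at *
  simp only [Bool.or_eq_true, Bool.and_eq_true, decide_eq_true_eq, or_assoc] at B
  have R := B hsum c1 c2 c3 c4 c5 c6 c7 c8 c9 c10 c11 c12 c13 c14 c15
  obtain ⟨⟨⟨⟨⟨r0, r1⟩, r2⟩, r3⟩, r6⟩, r7⟩ := R
  intro e he
  simp only [F0, Finset.mem_insert, Finset.mem_singleton] at he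
  rcases he with rfl | rfl | rfl | rfl | rfl | rfl <;> assumption

lemma wPu_edges (hG : ∀ e ∈ E8, e ∈ G.edgeSet) :
    (wPu hG).edges = [s(0,1), s(1,2), s(2,3), s(3,4)] := rfl
lemma wPl_edges (hG : ∀ e ∈ E8, e ∈ G.edgeSet) :
    (wPl hG).edges = [s(6,0), s(0,1), s(1,2), s(2,3), s(3,7)] := rfl
lemma wQ1_edges (hG : ∀ e ∈ E8, e ∈ G.edgeSet) :
    (wQ1 hG).edges = [s(0,5), s(5,4)] := rfl
lemma wQ2_edges (hG : ∀ e ∈ E8, e ∈ G.edgeSet) :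
    (wQ2 hG).edges = [s(6,2), s(2,3), s(3,7)] := rfl
lemma wQ3_edges (hG : ∀ e ∈ E8, e ∈ G.edgeSet) :
    (wQ3 hG).edges = [s(6,0), s(0,1), s(1,7)] := rfl

lemma not_efficient (hG : ∀ e ∈ E8, e ∈ G.edgeSet) : ¬ Efficient G 0 4 6 7 := by
  intro hE
  obtain ⟨F, ⟨⟨-, -, ⟨p, -, hp⟩, ⟨q, -, hq⟩⟩, hopt⟩, P₁, P₂, -, -, hu1, hu2, Ξ, hΞ, hN1, hN2⟩ :=
    hE (fun e => (cN e : ℝ)) (fun e => Nat.cast_nonneg _)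
  have pPu : (wPu hG).IsPath := isPath_of_support _ [0,1,2,3,4] rfl (by decide)
  have pPl : (wPl hG).IsPath := isPath_of_support _ [6,0,1,2,3,7] rfl (by decide)
  have pQ1 : (wQ1 hG).IsPath := isPath_of_support _ [0,5,4] rfl (by decide)
  have pQ2 : (wQ2 hG).IsPath := isPath_of_support _ [6,2,3,7] rfl (by decide)
  have pQ3 : (wQ3 hG).IsPath := isPath_of_support _ [6,0,1,7] rfl (by decide)
  have ePu : ∀ e ∈ (wPu hG).edges, e ∈ F0 := by rw [wPu_edges]; decide
  have ePl : ∀ e ∈ (wPl hG).edges, e ∈ F0 := by rw [wPl_edges]; decide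
  have hF0 : IsSteinerForest G 0 4 6 7 F0 := by
    refine ⟨?_, F0_acyclic, ⟨wPu hG, pPu, ePu⟩, ⟨wPl hG, pPl, ePl⟩⟩
    intro e he
    exact hG e ((by decide : F0 ⊆ E8) (by simpa using he))
  have hle := hopt F0 hF0
  have hc : ∑ e ∈ F, cN e ≤ 42 := by
    have h42 : ∑ e ∈ F0, cN e = 42 := by decide +kernel
    simp only [cost] at hle
    rw [← h42]
    exact_mod_cast hle
  have hsub : F0 ⊆ F := F0_sub hc p hp q hq
  obtain rfl := hu1 ⟨wPu hG, pPu⟩ (fun e he => hsub (ePu e he))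
  obtain rfl := hu2 ⟨wPl hG, pPl⟩ (fun e he => hsub (ePl e he))
  have d1 := hN1 ⟨wQ1 hG, pQ1⟩
  have d2 := hN2 ⟨wQ2 hG, pQ2⟩
  have d3 := hN2 ⟨wQ3 hG, pQ3⟩
  have b0 : ∀ (A : Strat G 0 4) (B : Strat G 6 7) (e), usedBy A B e = {0} →
      Ξ A B 0 e = cN e := by
    intro A B e h
    have := hΞ.budget A B e (by rw [h]; simp)
    rwa [h, Finset.sum_singleton] at this
  have b1 : ∀ (A : Strat G 0 4) (B : Strat G 6 7) (e), usedBy A B e = {1} →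
      Ξ A B 1 e = cN e := by
    intro A B e h
    have := hΞ.budget A B e (by rw [h]; simp)
    rwa [h, Finset.sum_singleton] at this
  have b01 : ∀ (A : Strat G 0 4) (B : Strat G 6 7) (e), usedBy A B e = {0, 1} →
      Ξ A B 0 e + Ξ A B 1 e = cN e := by
    intro A B e h
    have := hΞ.budget A B e (by rw [h]; simp)
    rwa [h, Finset.sum_pair (by decide)] at this
  have cPu : ∀ B, cost₁ Ξ ⟨wPu hG, pPu⟩ B = Ξ ⟨wPu hG, pPu⟩ B 0 s(0,1) +
      (Ξ ⟨wPu hG, pPu⟩ B 0 s(1,2) + (Ξ ⟨wPu hG, pPu⟩ B 0 s(2,3) +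
      Ξ ⟨wPu hG, pPu⟩ B 0 s(3,4))) := by
    intro B
    have : (wPu hG).edges.toFinset = {s(0,1), s(1,2), s(2,3), s(3,4)} := by
      rw [wPu_edges]; decide
    unfold cost₁
    rw [this]
    repeat rw [Finset.sum_insert (by decide)]
    rw [Finset.sum_singleton]
  have cPl : ∀ A, cost₂ Ξ A ⟨wPl hG, pPl⟩ = Ξ A ⟨wPl hG, pPl⟩ 1 s(6,0) +
      (Ξ A ⟨wPl hG, pPl⟩ 1 s(0,1) + (Ξ A ⟨wPl hG, pPl⟩ 1 s(1,2) +
      (Ξ A ⟨wPl hG, pPl⟩ 1 s(2,3) + Ξ A ⟨wPl hG, pPl⟩ 1 s(3,7)))) := by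
    intro A
    have : (wPl hG).edges.toFinset = {s(6,0), s(0,1), s(1,2), s(2,3), s(3,7)} := by
      rw [wPl_edges]; decide
    unfold cost₂
    rw [this]
    repeat rw [Finset.sum_insert (by decide)]
    rw [Finset.sum_singleton]
  have cQ1 : ∀ B, cost₁ Ξ ⟨wQ1 hG, pQ1⟩ B = Ξ ⟨wQ1 hG, pQ1⟩ B 0 s(0,5) +
      Ξ ⟨wQ1 hG, pQ1⟩ B 0 s(5,4) := by
    intro B
    have : (wQ1 hG).edges.toFinset = {s(0,5), s(5,4)} := by
      rw [wQ1_edges]; decide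
    unfold cost₁
    rw [this, Finset.sum_pair (by decide)]
  have cQ2 : ∀ A, cost₂ Ξ A ⟨wQ2 hG, pQ2⟩ = Ξ A ⟨wQ2 hG, pQ2⟩ 1 s(6,2) +
      (Ξ A ⟨wQ2 hG, pQ2⟩ 1 s(2,3) + Ξ A ⟨wQ2 hG, pQ2⟩ 1 s(3,7)) := by
    intro A
    have : (wQ2 hG).edges.toFinset = {s(6,2), s(2,3), s(3,7)} := by
      rw [wQ2_edges]; decide
    unfold cost₂
    rw [this]
    repeat rw [Finset.sum_insert (by decide)]
    rw [Finset.sum_singleton]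
  have cQ3 : ∀ A, cost₂ Ξ A ⟨wQ3 hG, pQ3⟩ = Ξ A ⟨wQ3 hG, pQ3⟩ 1 s(6,0) +
      (Ξ A ⟨wQ3 hG, pQ3⟩ 1 s(0,1) + Ξ A ⟨wQ3 hG, pQ3⟩ 1 s(1,7)) := by
    intro A
    have : (wQ3 hG).edges.toFinset = {s(6,0), s(0,1), s(1,7)} := by
      rw [wQ3_edges]; decide
    unfold cost₂
    rw [this]
    repeat rw [Finset.sum_insert (by decide)]
    rw [Finset.sum_singleton]
  rw [cPu, cQ1] at d1
  rw [cPl, cQ2] at d2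
  rw [cPl, cQ3] at d3
  have u1 := b01 ⟨wPu hG, pPu⟩ ⟨wPl hG, pPl⟩ s(0,1)
    (by unfold usedBy; rw [wPu_edges, wPl_edges]; decide)
  have u2 := b01 ⟨wPu hG, pPu⟩ ⟨wPl hG, pPl⟩ s(1,2)
    (by unfold usedBy; rw [wPu_edges, wPl_edges]; decide)
  have u3 := b01 ⟨wPu hG, pPu⟩ ⟨wPl hG, pPl⟩ s(2,3)
    (by unfold usedBy; rw [wPu_edges, wPl_edges]; decide)
  have u4 := b0 ⟨wPu hG, pPu⟩ ⟨wPl hG, pPl⟩ s(3,4)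
    (by unfold usedBy; rw [wPu_edges, wPl_edges]; decide)
  have u5 := b1 ⟨wPu hG, pPu⟩ ⟨wPl hG, pPl⟩ s(6,0)
    (by unfold usedBy; rw [wPu_edges, wPl_edges]; decide)
  have u6 := b1 ⟨wPu hG, pPu⟩ ⟨wPl hG, pPl⟩ s(3,7)
    (by unfold usedBy; rw [wPu_edges, wPl_edges]; decide)
  have v1 := b0 ⟨wQ1 hG, pQ1⟩ ⟨wPl hG, pPl⟩ s(0,5)
    (by unfold usedBy; rw [wQ1_edges, wPl_edges]; decide)
  have v2 := b0 ⟨wQ1 hG, pQ1⟩ ⟨wPl hG, pPl⟩ s(5,4)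
    (by unfold usedBy; rw [wQ1_edges, wPl_edges]; decide)
  have v3 := b1 ⟨wPu hG, pPu⟩ ⟨wQ2 hG, pQ2⟩ s(6,2)
    (by unfold usedBy; rw [wPu_edges, wQ2_edges]; decide)
  have v4 := b1 ⟨wPu hG, pPu⟩ ⟨wQ2 hG, pQ2⟩ s(3,7)
    (by unfold usedBy; rw [wPu_edges, wQ2_edges]; decide)
  have v5 := hΞ.separable ⟨wPu hG, pPu⟩ ⟨wQ2 hG, pQ2⟩ ⟨wPu hG, pPu⟩ ⟨wPl hG, pPl⟩ s(2,3)
    (by unfold usedBy; rw [wPu_edges, wQ2_edges, wPl_edges]; decide) 1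
  have v6 := b1 ⟨wPu hG, pPu⟩ ⟨wQ3 hG, pQ3⟩ s(6,0)
    (by unfold usedBy; rw [wPu_edges, wQ3_edges]; decide)
  have v7 := b1 ⟨wPu hG, pPu⟩ ⟨wQ3 hG, pQ3⟩ s(1,7)
    (by unfold usedBy; rw [wPu_edges, wQ3_edges]; decide)
  have v8 := hΞ.separable ⟨wPu hG, pPu⟩ ⟨wQ3 hG, pQ3⟩ ⟨wPu hG, pPu⟩ ⟨wPl hG, pPl⟩ s(0,1)
    (by unfold usedBy; rw [wPu_edges, wQ3_edges, wPl_edges]; decide) 1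
  have n2 := hΞ.nonneg ⟨wPu hG, pPu⟩ ⟨wPl hG, pPl⟩ 1 s(1,2)
  rw [show cN s(0,1) = 4 by decide] at u1
  rw [show cN s(1,2) = 4 by decide] at u2
  rw [show cN s(2,3) = 4 by decide] at u3
  rw [show cN s(3,4) = 10 by decide] at u4
  rw [show cN s(6,0) = 10 by decide] at u5 v6
  rw [show cN s(3,7) = 10 by decide] at u6 v4
  rw [show cN s(0,5) = 8 by decide] at v1
  rw [show cN s(5,4) = 9 by decide] at v2
  rw [show cN s(6,2) = 12 by decide] at v3
  rw [show cN s(1,7) = 12 by decide] at v7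
  push_cast at *
  linarith

end generic

lemma chordal_top {N : ℕ} : Chordal (⊤ : SimpleGraph (Fin N)) := by
  intro y p hp hlen
  by_contra hno
  push Not at hno
  have h2 := hp.ncard_neighborSet_toSubgraph_eq_two p.start_mem_support
  have hsub : (↑(p.support.tail.toFinset) : Set (Fin N)) ⊆
      insert y (p.toSubgraph.neighborSet y) := by
    intro d hd
    have hd' : d ∈ p.support := by
      have : d ∈ p.support.tail := by simpa using hd
      exact List.mem_of_mem_tail this
    by_cases hyd : d = y
    · exact Or.inl hyd
    · right
      rw [Subgraph.mem_neighborSet, Walk.adj_toSubgraph_iff_mem_edges]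
      exact hno y d p.start_mem_support hd' (by simpa using Ne.symm hyd)
  have h3 := Set.ncard_le_ncard hsub (Set.toFinite _)
  have h4 := Set.ncard_insert_le y (p.toSubgraph.neighborSet y)
  rw [Set.ncard_coe_finset, List.toFinset_card_of_nodup hp.support_nodup] at h3
  have h5 : p.support.tail.length = p.length := by simp
  omega

/-- The base graph. -/
def B8 : SimpleGraph (Fin 8) := fromEdgeSet (↑E8 : Set (Sym2 (Fin 8)))

lemma B8_edge : ∀ e ∈ E8, e ∈ B8.edgeSet := by
  intro e he
  unfold B8
  rw [edgeSet_fromEdgeSet]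
  refine ⟨by simpa using he, ?_⟩
  have : ∀ e ∈ E8, ¬ e.IsDiag := by decide
  exact this e he

lemma B8_adj {a b : Fin 8} (h : B8.Adj a b) : s(a,b) ∈ E8 := by
  unfold B8 at h
  rw [fromEdgeSet_adj] at h
  simpa using h.1

lemma B8_bip : B8.Colorable 2 := by
  refine ⟨Coloring.mk (![0,1,0,1,0,1,1,0] : Fin 8 → Fin 2) ?_⟩
  intro a b h
  have : ∀ a b : Fin 8, s(a,b) ∈ E8 →
    (![0,1,0,1,0,1,1,0] : Fin 8 → Fin 2) a ≠ (![0,1,0,1,0,1,1,0] : Fin 8 → Fin 2) b := by decide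
  exact this a b (B8_adj h)

lemma E8_deg : ∀ z : Fin 8, ∃ e ∈ E8, ∃ e' ∈ E8, z ∈ e ∧ z ∈ e' ∧ e ≠ e' := by decide +kernel

/-- Counting lemma: a family of at most six disjoint connected branch sets with at least
nine cross edges cannot exist in `B8`. -/
lemma no_branch {k : ℕ} (hk : k ≤ 6) (S : Fin k → Set (Fin 8))
    (hconn : ∀ i, (B8.induce (S i)).Connected)
    (hdis : ∀ i j, i ≠ j → Disjoint (S i) (S j))
    (X : Finset (Sym2 (Fin 8))) (hX : 9 ≤ X.card) (hXE : X ⊆ E8)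
    (hXS : ∀ e ∈ X, ∃ i j p q, i ≠ j ∧ p ∈ S i ∧ q ∈ S j ∧ e = s(p,q)) : False := by
  have huniq : ∀ i j z, z ∈ S i → z ∈ S j → i = j := by
    intro i j z h1 h2
    by_contra h
    exact Set.disjoint_left.1 (hdis i j h) h1 h2
  -- at most one edge of `E8` is not in `X`
  have hone : ∀ e ∈ E8, ∀ e' ∈ E8, e ∉ X → e' ∉ X → e = e' := by
    intro e he e' he' hn hn'
    have h1 : (E8 \ X).card ≤ 1 := by
      rw [Finset.card_sdiff_of_subset hXE]
      have : E8.card = 10 := by decide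
      omega
    exact Finset.card_le_one.1 h1 e (by simp [he, hn]) e' (by simp [he', hn'])
  -- every vertex lies in a branch set
  have hcov : ∀ z : Fin 8, ∃ i, z ∈ S i := by
    intro z
    obtain ⟨e, he, e', he', hz, hz', hne⟩ := E8_deg z
    have : e ∈ X ∨ e' ∈ X := by
      by_contra h
      push Not at h
      exact hne (hone e he e' he' h.1 h.2)
    have aux : ∀ e ∈ X, z ∈ e → ∃ i, z ∈ S i := by
      intro e he hz
      obtain ⟨i, j, p, q, -, hp, hq, rfl⟩ := hXS e he
      rcases Sym2.mem_iff.1 hz with rfl | rfl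
      · exact ⟨i, hp⟩
      · exact ⟨j, hq⟩
    rcases this with h | h
    · exact aux e h hz
    · exact aux e' h hz'
  choose f hf using hcov
  -- a vertex sharing its class is incident to an internal edge
  have hinner : ∀ z z', z ≠ z' → f z = f z' → ∃ y, s(z,y) ∈ E8 ∧ s(z,y) ∉ X := by
    intro z z' hne hff
    have hz' : z' ∈ S (f z) := hff ▸ hf z'
    obtain ⟨w⟩ := (hconn (f z)).preconnected ⟨z, hf z⟩ ⟨z', hz'⟩
    cases w with
    | nil => exact absurd rfl hne
    | @cons _ y _ h _ =>
      refine ⟨y.1, B8_adj h, ?_⟩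
      intro hx
      obtain ⟨i, j, p, q, hij, hp, hq, he⟩ := hXS _ hx
      rcases Sym2.eq_iff.1 he with ⟨h1, h2⟩ | ⟨h1, h2⟩
      · subst h1
        rw [← h2] at hq
        exact hij ((huniq _ _ _ hp (hf _)).trans (huniq _ _ _ y.2 hq))
      · subst h1
        rw [← h2] at hp
        exact hij ((huniq _ _ _ hp y.2).trans (huniq _ _ _ (hf _) hq))
  obtain ⟨a, b, hab, hfab⟩ := Fintype.exists_ne_map_eq_of_card_lt f (by simp; omega)
  -- remove `a`: still seven vertices in at most six classes
  obtain ⟨c, d, hcd, hfcd⟩ := Fintype.exists_ne_map_eq_of_card_lt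
    (fun z : {z : Fin 8 // z ≠ a} => f z.1)
    (by rw [Fintype.card_subtype_compl]; simp; omega)
  have hcd' : c.1 ≠ d.1 := fun h => hcd (Subtype.ext h)
  obtain ⟨y1, e1, n1⟩ := hinner a b hab hfab
  obtain ⟨y2, e2, n2⟩ := hinner b a hab.symm hfab.symm
  obtain ⟨y3, e3, n3⟩ := hinner c.1 d.1 hcd' hfcd
  obtain ⟨y4, e4, n4⟩ := hinner d.1 c.1 hcd'.symm hfcd.symm
  have q12 := hone _ e1 _ e2 n1 n2
  have q13 := hone _ e1 _ e3 n1 n3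
  have q14 := hone _ e1 _ e4 n1 n4
  have m2 : b ∈ s(a,y1) := by rw [q12]; simp
  have m3 : c.1 ∈ s(a,y1) := by rw [q13]; simp
  have m4 : d.1 ∈ s(a,y1) := by rw [q14]; simp
  rw [Sym2.mem_iff] at m3 m4
  have := c.2
  have := d.2
  grind

lemma B8_planar : Planar B8 := by
  constructor
  · rintro ⟨S, -, hconn, hdis, hadj⟩
    have h' : ∀ x : Fin 5 × Fin 5, ∃ e, x.1 < x.2 → e ∈ E8 ∧
        ∃ p q, p ∈ S x.1 ∧ q ∈ S x.2 ∧ e = s(p,q) := by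
      intro x
      by_cases h : x.1 < x.2
      · obtain ⟨p, hp, q, hq, hpq⟩ := hadj x.1 x.2 h.ne
        exact ⟨s(p,q), fun _ => ⟨B8_adj hpq, p, q, hp, hq, rfl⟩⟩
      · exact ⟨s(0,0), fun h' => absurd h' h⟩
    choose g hg using h'
    have huniq : ∀ i j z, z ∈ S i → z ∈ S j → i = j := by
      intro i j z h1 h2
      by_contra h
      exact Set.disjoint_left.1 (hdis i j h) h1 h2
    let D : Finset (Fin 5 × Fin 5) := Finset.univ.filter (fun x => x.1 < x.2)
    refine no_branch (by norm_num) S hconn hdis (D.image g) ?_ ?_ ?_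
    · rw [Finset.card_image_of_injOn]
      · decide
      · intro x hx x' hx' he
        have hx1 : x.1 < x.2 := by simpa [D] using hx
        have hx2 : x'.1 < x'.2 := by simpa [D] using hx'
        obtain ⟨-, p, q, hp, hq, h1⟩ := hg x hx1
        obtain ⟨-, p', q', hp', hq', h2⟩ := hg x' hx2
        have he' : g x = g x' := he
        rw [h1, h2] at he'
        rcases Sym2.eq_iff.1 he' with ⟨rfl, rfl⟩ | ⟨rfl, rfl⟩
        · exact Prod.ext (huniq _ _ _ hp hp') (huniq _ _ _ hq hq')
        · have a1 := huniq _ _ _ hp hq'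
          have a2 := huniq _ _ _ hq hp'
          rw [a1, a2] at hx1
          exact absurd hx1 hx2.asymm
    · intro e he
      obtain ⟨x, hx, rfl⟩ := Finset.mem_image.1 he
      exact (hg x (by simpa [D] using hx)).1
    · intro e he
      obtain ⟨x, hx, rfl⟩ := Finset.mem_image.1 he
      have hx1 : x.1 < x.2 := by simpa [D] using hx
      obtain ⟨-, p, q, hp, hq, h1⟩ := hg x hx1
      exact ⟨x.1, x.2, p, q, hx1.ne, hp, hq, h1⟩
  · rintro ⟨S, T, -, -, hcS, hcT, hdS, hdT, hdST, hadj⟩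
    have h' : ∀ x : Fin 3 × Fin 3, ∃ e, e ∈ E8 ∧
        ∃ p q, p ∈ S x.1 ∧ q ∈ T x.2 ∧ e = s(p,q) := by
      intro x
      obtain ⟨p, hp, q, hq, hpq⟩ := hadj x.1 x.2
      exact ⟨s(p,q), B8_adj hpq, p, q, hp, hq, rfl⟩
    choose g hg using h'
    have huS : ∀ i j z, z ∈ S i → z ∈ S j → i = j := by
      intro i j z h1 h2
      by_contra h
      exact Set.disjoint_left.1 (hdS i j h) h1 h2
    have huT : ∀ i j z, z ∈ T i → z ∈ T j → i = j := by
      intro i j z h1 h2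
      by_contra h
      exact Set.disjoint_left.1 (hdT i j h) h1 h2
    let U : Fin (3 + 3) → Set (Fin 8) := Fin.append S T
    have hUl : ∀ i : Fin 3, U (Fin.castAdd 3 i) = S i := fun i => Fin.append_left S T i
    have hUr : ∀ i : Fin 3, U (Fin.natAdd 3 i) = T i := fun i => Fin.append_right S T i
    have hlr : ∀ i j : Fin 3, Fin.castAdd 3 i ≠ Fin.natAdd 3 j := by decide
    refine no_branch (k := 3 + 3) (le_refl 6) U ?_ ?_ (Finset.univ.image g) ?_ ?_ ?_
    · intro i
      induction i using Fin.addCases with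
      | left i => rw [hUl]; exact hcS i
      | right i => rw [hUr]; exact hcT i
    · intro i j
      induction i using Fin.addCases with
      | left i =>
        induction j using Fin.addCases with
        | left j => intro h; rw [hUl, hUl]; exact hdS i j (fun h' => h (by rw [h']))
        | right j => intro _; rw [hUl, hUr]; exact hdST i j
      | right i =>
        induction j using Fin.addCases with
        | left j => intro _; rw [hUl, hUr]; exact (hdST j i).symm
        | right j => intro h; rw [hUr, hUr]; exact hdT i j (fun h' => h (by rw [h']))
    · rw [Finset.card_image_of_injective]
      · simp
      · intro x x' he
        obtain ⟨-, p, q, hp, hq, h1⟩ := hg x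
        obtain ⟨-, p', q', hp', hq', h2⟩ := hg x'
        rw [h1, h2] at he
        rcases Sym2.eq_iff.1 he with ⟨rfl, rfl⟩ | ⟨rfl, rfl⟩
        · exact Prod.ext (huS _ _ _ hp hp') (huT _ _ _ hq hq')
        · exact absurd hq' (Set.disjoint_left.1 (hdST _ _) hp)
    · intro e he
      obtain ⟨x, -, rfl⟩ := Finset.mem_image.1 he
      exact (hg x).1
    · intro e he
      obtain ⟨x, -, rfl⟩ := Finset.mem_image.1 he
      obtain ⟨-, p, q, hp, hq, h1⟩ := hg x
      exact ⟨Fin.castAdd 3 x.1, Fin.natAdd 3 x.2, p, q, hlr _ _, by rw [hUl]; exact hp,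
        by rw [hUr]; exact hq, h1⟩

lemma top_edge : ∀ e ∈ E8, e ∈ (⊤ : SimpleGraph (Fin 8)).edgeSet :=
  fun e he => edgeSet_mono le_top (B8_edge e he)

/-- Each of the classes of bipartite graphs, chordal graphs
and planar graphs contains a non-efficient graph: in each class there is a
graph which, together with suitable terminal placements, contains a bad
configuration of type BC1a and hence is not efficient. -/
theorem bipartite_chordal_planar_contain_non_efficient_graphs :
    (∃ (N : ℕ) (G : SimpleGraph (Fin N)) (s₁ t₁ s₂ t₂ : Fin N),
      G.Colorable 2 ∧ ContainsBC1a G s₁ t₁ s₂ t₂ ∧ ¬ Efficient G s₁ t₁ s₂ t₂) ∧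
    (∃ (N : ℕ) (G : SimpleGraph (Fin N)) (s₁ t₁ s₂ t₂ : Fin N),
      Chordal G ∧ ContainsBC1a G s₁ t₁ s₂ t₂ ∧ ¬ Efficient G s₁ t₁ s₂ t₂) ∧
    (∃ (N : ℕ) (G : SimpleGraph (Fin N)) (s₁ t₁ s₂ t₂ : Fin N),
      Planar G ∧ ContainsBC1a G s₁ t₁ s₂ t₂ ∧ ¬ Efficient G s₁ t₁ s₂ t₂) := by
  exact ⟨⟨8, B8, 0, 4, 6, 7, B8_bip, containsBC1a B8_edge, not_efficient B8_edge⟩,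
    ⟨8, ⊤, 0, 4, 6, 7, chordal_top, containsBC1a top_edge, not_efficient top_edge⟩,
    ⟨8, B8, 0, 4, 6, 7, B8_planar, containsBC1a B8_edge, not_efficient B8_edge⟩⟩

end NDG
end

section
/- The price of stability for two-player undirected network design games with separable cost-sharing protocols is at least 15/14. More precisely, for every x>0 there is a two-player instance (G,c,(s_1,t_1),(s_2,t_2)) in which the unique optimal Steiner forest has cost 14x+8 and is not enforceable, while some enforceable Steiner forest has cost 15x+8; consequently, for every ε>0 there is an instance in which every enforceable Steiner forest has cost at least (15/14 − ε) times the cost of an optimal Steiner forest. -/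
namespace NDG

/-! ### The instance

Vertices: `0 = s₁`, `1 = s₂`, `2`, `3`, `4`, `5 = t₁`, `6 = t₂`. -/

/-- The edges of the instance. -/
def exE : Finset (Sym2 (Fin 7)) :=
  {s(0, 1), s(0, 3), s(1, 2), s(2, 3), s(3, 4), s(4, 5), s(2, 5), s(4, 6), s(1, 6)}

/-- The graph of the instance. -/
def exG : SimpleGraph (Fin 7) := SimpleGraph.fromEdgeSet (↑exE : Set (Sym2 (Fin 7)))

/-- The coefficient of `x` in the edge cost. -/
def exA (e : Sym2 (Fin 7)) : ℕ :=
  if e = s(0, 1) then 3 else if e = s(0, 3) then 4 else if e = s(1, 2) then 2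
  else if e = s(2, 3) then 1 else if e = s(3, 4) then 2 else if e = s(4, 5) then 3
  else if e = s(2, 5) then 4 else if e = s(4, 6) then 3 else 6

/-- The constant part of the edge cost. -/
def exB (e : Sym2 (Fin 7)) : ℕ :=
  if e = s(0, 1) then 2 else if e = s(0, 3) then 2 else if e = s(1, 2) then 1
  else if e = s(2, 3) then 1 else if e = s(3, 4) then 1 else if e = s(4, 5) then 2
  else if e = s(2, 5) then 2 else if e = s(4, 6) then 1 else 3

/-- The edge costs. -/
noncomputable def exC (x : ℝ) (e : Sym2 (Fin 7)) : ℝ := exA e * x + exB e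

/-- The optimal Steiner forest. -/
def exF : Finset (Sym2 (Fin 7)) := {s(0, 1), s(1, 2), s(2, 3), s(3, 4), s(4, 5), s(4, 6)}

/-- The enforceable Steiner forest. -/
def exFalt : Finset (Sym2 (Fin 7)) := {s(0, 3), s(3, 4), s(4, 5), s(1, 6)}

theorem exC_nonneg {x : ℝ} (hx : 0 < x) (e) : 0 ≤ exC x e := by
  unfold exC; positivity

theorem ex_adj {a b : Fin 7} (h : s(a, b) ∈ exE) (hab : a ≠ b) : exG.Adj a b := by
  simp only [exG, SimpleGraph.fromEdgeSet_adj, Finset.mem_coe]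
  exact ⟨h, hab⟩

theorem ex_edgeSet : exG.edgeSet = (↑exE : Set (Sym2 (Fin 7))) := by
  unfold exG
  rw [SimpleGraph.edgeSet_fromEdgeSet, sdiff_eq_left, Set.disjoint_left]
  intro e he
  have : ∀ e ∈ exE, ¬ e.IsDiag := by decide
  exact this e he

/-- A finite acyclicity criterion through cuts. -/
theorem acyclic_of_cuts (F : Finset (Sym2 (Fin 7)))
    (h : ∀ a b, s(a, b) ∈ F → ∃ S : Finset (Fin 7), a ∈ S ∧ b ∉ S ∧
      ∀ c d, s(c, d) ∈ F → c ∈ S → d ∉ S → s(c, d) = s(a, b)) :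
    (SimpleGraph.fromEdgeSet (↑F : Set (Sym2 (Fin 7)))).IsAcyclic := by
  rw [SimpleGraph.isAcyclic_iff_forall_isBridge]
  intro e
  induction e with
  | _ a b =>
  intro he
  rw [SimpleGraph.isBridge_iff_forall_walk_mem_edges]
  intro p
  simp only [SimpleGraph.mem_edgeSet, SimpleGraph.fromEdgeSet_adj, Finset.mem_coe] at he
  obtain ⟨S, ha, hb, hS⟩ := h a b he.1
  obtain ⟨d, hd, h1, h2⟩ := p.exists_boundary_dart (↑S) (by simpa using ha) (by simpa using hb)
  have hadj := d.adj
  simp only [SimpleGraph.fromEdgeSet_adj, Finset.mem_coe] at hadj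
  rw [← hS d.fst d.snd hadj.1 (by simpa using h1) (by simpa using h2)]
  exact List.mem_map_of_mem (f := SimpleGraph.Dart.edge) hd

theorem exF_acyclic : (SimpleGraph.fromEdgeSet (↑exF : Set (Sym2 (Fin 7)))).IsAcyclic := by
  apply acyclic_of_cuts
  decide +kernel

theorem exFalt_acyclic : (SimpleGraph.fromEdgeSet (↑exFalt : Set (Sym2 (Fin 7)))).IsAcyclic := by
  apply acyclic_of_cuts
  decide +kernel

/-- Paths inside an acyclic edge set are unique. -/
theorem path_unique_in {F : Finset (Sym2 (Fin 7))}
    (hF : (SimpleGraph.fromEdgeSet (↑F : Set (Sym2 (Fin 7)))).IsAcyclic) {s t : Fin 7}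
    (p q : Strat exG s t) (hp : ∀ e ∈ p.1.edges, e ∈ F) (hq : ∀ e ∈ q.1.edges, e ∈ F) :
    p = q := by
  have key : ∀ r : Strat exG s t, (∀ e ∈ r.1.edges, e ∈ F) → ∀ e ∈ r.1.edges,
      e ∈ (SimpleGraph.fromEdgeSet (↑F : Set (Sym2 (Fin 7)))).edgeSet := by
    intro r hr e he
    rw [SimpleGraph.edgeSet_fromEdgeSet]
    exact ⟨hr e he, exG.not_isDiag_of_mem_edgeSet (r.1.edges_subset_edgeSet he)⟩
  have := (hF.subsingleton_path s t).elim ⟨p.1.transfer _ (key p hp), p.2.transfer _⟩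
    ⟨q.1.transfer _ (key q hq), q.2.transfer _⟩
  have h2 := congrArg (fun w => w.1.support) this
  simp only [SimpleGraph.Walk.support_transfer] at h2
  exact Subtype.ext (SimpleGraph.Walk.ext_support h2)

/-- Every walk crosses every separating cut. -/
theorem cut_mem {s t : Fin 7} (p : exG.Walk s t) {F : Finset (Sym2 (Fin 7))}
    (hp : ∀ e ∈ p.edges, e ∈ F) (S : Finset (Fin 7)) (hs : s ∈ S) (ht : t ∉ S)
    (K : List (Sym2 (Fin 7)))
    (hK : ∀ a ∈ S, ∀ b, b ∉ S → s(a, b) ∈ exE → s(a, b) ∈ K) :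
    ∃ e ∈ K, e ∈ F := by
  obtain ⟨d, hd, h1, h2⟩ := p.exists_boundary_dart (↑S) (by simpa using hs) (by simpa using ht)
  have he : d.edge ∈ p.edges := List.mem_map_of_mem (f := SimpleGraph.Dart.edge) hd
  have hadj := p.edges_subset_edgeSet he
  rw [ex_edgeSet] at hadj
  exact ⟨d.edge, hK d.fst (by simpa using h1) d.snd (by simpa using h2) hadj, hp _ he⟩

theorem ex_sum {F : Finset (Sym2 (Fin 7))} (hF : F ⊆ exE) (f : Sym2 (Fin 7) → ℕ) :
    ∑ e ∈ F, f e =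
      (if s(0, 1) ∈ F then f s(0, 1) else 0) + (if s(0, 3) ∈ F then f s(0, 3) else 0)
      + (if s(1, 2) ∈ F then f s(1, 2) else 0) + (if s(2, 3) ∈ F then f s(2, 3) else 0)
      + (if s(3, 4) ∈ F then f s(3, 4) else 0) + (if s(4, 5) ∈ F then f s(4, 5) else 0)
      + (if s(2, 5) ∈ F then f s(2, 5) else 0) + (if s(4, 6) ∈ F then f s(4, 6) else 0)
      + (if s(1, 6) ∈ F then f s(1, 6) else 0) := by
  have h1 : ∑ e ∈ F, f e = ∑ e ∈ exE, if e ∈ F then f e else 0 := by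
    rw [← Finset.sum_filter, Finset.filter_mem_eq_inter, Finset.inter_eq_right.mpr hF]
  rw [h1]
  unfold exE
  repeat rw [Finset.sum_insert (by decide)]
  rw [Finset.sum_singleton]
  ring

theorem ex_cost (x : ℝ) (F : Finset (Sym2 (Fin 7))) :
    cost (exC x) F = ((∑ e ∈ F, exA e : ℕ) : ℝ) * x + ((∑ e ∈ F, exB e : ℕ) : ℝ) := by
  unfold cost exC
  rw [Finset.sum_add_distrib, ← Finset.sum_mul]
  push_cast
  rfl

theorem core1 : ∀ b0 b1 b2 b3 b4 b5 b6 b7 b8 : Bool,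
    (b5 || b6) → (b1 || b2 || b4 || b5) → (b0 || b1) → (b1 || b3 || b6 || b8) →
    (b0 || b3 || b5 || b8) → (b4 || b6 || b7) →
    9 ≤ (if b0 then 3 else 0) + (if b1 then 4 else 0) + (if b2 then 2 else 0)
      + (if b3 then 1 else 0) + (if b4 then 2 else 0) + (if b5 then 3 else 0)
      + (if b6 then 4 else 0) + (if b7 then 3 else 0) + (if b8 then 6 else 0) ∧
    5 ≤ (if b0 then 2 else 0) + (if b1 then 2 else 0) + (if b2 then 1 else 0)
      + (if b3 then 1 else 0) + (if b4 then 1 else 0) + (if b5 then 2 else 0)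
      + (if b6 then 2 else 0) + (if b7 then 1 else 0) + (if b8 then 3 else 0) := by
  decide +kernel

theorem core2 : ∀ b0 b1 b2 b3 b4 b5 b6 b7 b8 : Bool,
    (b7 || b8) → (b0 || b2 || b8) → (b0 || b3 || b5 || b8) →
    6 ≤ (if b0 then 3 else 0) + (if b1 then 4 else 0) + (if b2 then 2 else 0)
      + (if b3 then 1 else 0) + (if b4 then 2 else 0) + (if b5 then 3 else 0)
      + (if b6 then 4 else 0) + (if b7 then 3 else 0) + (if b8 then 6 else 0) ∧
    3 ≤ (if b0 then 2 else 0) + (if b1 then 2 else 0) + (if b2 then 1 else 0)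
      + (if b3 then 1 else 0) + (if b4 then 1 else 0) + (if b5 then 2 else 0)
      + (if b6 then 2 else 0) + (if b7 then 1 else 0) + (if b8 then 3 else 0) := by
  decide +kernel

set_option synthInstance.maxSize 2000 in
set_option synthInstance.maxHeartbeats 400000 in
theorem core3 : ∀ b0 b1 b2 b3 b4 b5 b6 b7 b8 : Bool,
    (b0 || b3 || b6 || b8) → (b0 || b1) → (b1 || b3 || b6 || b8) → (b7 || b8) →
    (b4 || b6 || b8) → (b4 || b5 || b8) → (b0 || b3 || b5 || b8) → (b4 || b6 || b7) →
    (b0 || b2 || b8) → (b1 || b2 || b7) → (b5 || b6) → (b1 || b2 || b8) →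
    (b1 || b3 || b5 || b8) → (b0 || b3 || b5 || b7) →
    (b0 ∧ ¬ b1 ∧ b2 ∧ b3 ∧ b4 ∧ b5 ∧ ¬ b6 ∧ b7 ∧ ¬ b8) ∨
    (15 ≤ (if b0 then 3 else 0) + (if b1 then 4 else 0) + (if b2 then 2 else 0)
      + (if b3 then 1 else 0) + (if b4 then 2 else 0) + (if b5 then 3 else 0)
      + (if b6 then 4 else 0) + (if b7 then 3 else 0) + (if b8 then 6 else 0) ∧
    8 ≤ (if b0 then 2 else 0) + (if b1 then 2 else 0) + (if b2 then 1 else 0)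
      + (if b3 then 1 else 0) + (if b4 then 1 else 0) + (if b5 then 2 else 0)
      + (if b6 then 2 else 0) + (if b7 then 1 else 0) + (if b8 then 3 else 0)) := by
  decide +kernel

theorem exA_sum {F : Finset (Sym2 (Fin 7))} (hF : F ⊆ exE) :
    ∑ e ∈ F, exA e =
      (if s(0, 1) ∈ F then 3 else 0) + (if s(0, 3) ∈ F then 4 else 0)
      + (if s(1, 2) ∈ F then 2 else 0) + (if s(2, 3) ∈ F then 1 else 0)
      + (if s(3, 4) ∈ F then 2 else 0) + (if s(4, 5) ∈ F then 3 else 0)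
      + (if s(2, 5) ∈ F then 4 else 0) + (if s(4, 6) ∈ F then 3 else 0)
      + (if s(1, 6) ∈ F then 6 else 0) := ex_sum hF exA

theorem exB_sum {F : Finset (Sym2 (Fin 7))} (hF : F ⊆ exE) :
    ∑ e ∈ F, exB e =
      (if s(0, 1) ∈ F then 2 else 0) + (if s(0, 3) ∈ F then 2 else 0)
      + (if s(1, 2) ∈ F then 1 else 0) + (if s(2, 3) ∈ F then 1 else 0)
      + (if s(3, 4) ∈ F then 1 else 0) + (if s(4, 5) ∈ F then 2 else 0)
      + (if s(2, 5) ∈ F then 2 else 0) + (if s(4, 6) ∈ F then 1 else 0)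
      + (if s(1, 6) ∈ F then 3 else 0) := ex_sum hF exB

/-- Every `s₁`-`t₁` connection costs at least `9x+5`. -/
theorem ex_dist1 {x : ℝ} (hx : 0 < x) (p : exG.Walk 0 5) :
    9 * x + 5 ≤ cost (exC x) p.edges.toFinset := by
  set F := p.edges.toFinset with hFdef
  have hF : F ⊆ exE := by
    intro e he
    have := p.edges_subset_edgeSet (List.mem_toFinset.mp he)
    rwa [ex_edgeSet] at this
  have hp : ∀ e ∈ p.edges, e ∈ F := fun e he => List.mem_toFinset.mpr he
  have k1 := cut_mem p hp {0, 1, 2, 3, 4, 6} (by decide) (by decide) [s(4, 5), s(2, 5)] (by decide)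
  have k2 := cut_mem p hp {0, 1, 4, 6} (by decide) (by decide)
    [s(0, 3), s(1, 2), s(3, 4), s(4, 5)] (by decide)
  have k3 := cut_mem p hp {0} (by decide) (by decide) [s(0, 1), s(0, 3)] (by decide)
  have k4 := cut_mem p hp {0, 1, 2} (by decide) (by decide)
    [s(0, 3), s(2, 3), s(2, 5), s(1, 6)] (by decide)
  have k5 := cut_mem p hp {0, 3, 4, 6} (by decide) (by decide)
    [s(0, 1), s(2, 3), s(4, 5), s(1, 6)] (by decide)
  have k6 := cut_mem p hp {0, 1, 2, 3, 6} (by decide) (by decide)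
    [s(3, 4), s(2, 5), s(4, 6)] (by decide)
  simp only [List.mem_cons, List.not_mem_nil, or_false, exists_eq_or_imp, exists_eq_left] at k1 k2 k3 k4 k5 k6
  have := core1 (decide (s(0, 1) ∈ F)) (decide (s(0, 3) ∈ F)) (decide (s(1, 2) ∈ F))
    (decide (s(2, 3) ∈ F)) (decide (s(3, 4) ∈ F)) (decide (s(4, 5) ∈ F))
    (decide (s(2, 5) ∈ F)) (decide (s(4, 6) ∈ F)) (decide (s(1, 6) ∈ F))
  simp only [Bool.or_eq_true, decide_eq_true_eq, or_assoc] at this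
  have := this k1 k2 k3 k4 k5 k6
  rw [← exA_sum hF, ← exB_sum hF] at this
  have h1 : ((9 : ℕ) : ℝ) ≤ ((∑ e ∈ F, exA e : ℕ) : ℝ) := Nat.cast_le.mpr this.1
  have h2 : ((5 : ℕ) : ℝ) ≤ ((∑ e ∈ F, exB e : ℕ) : ℝ) := Nat.cast_le.mpr this.2
  rw [ex_cost]
  push_cast at h1 h2 ⊢
  nlinarith

/-- Every `s₂`-`t₂` connection costs at least `6x+3`. -/
theorem ex_dist2 {x : ℝ} (hx : 0 < x) (p : exG.Walk 1 6) :
    6 * x + 3 ≤ cost (exC x) p.edges.toFinset := by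
  set F := p.edges.toFinset with hFdef
  have hF : F ⊆ exE := by
    intro e he
    have := p.edges_subset_edgeSet (List.mem_toFinset.mp he)
    rwa [ex_edgeSet] at this
  have hp : ∀ e ∈ p.edges, e ∈ F := fun e he => List.mem_toFinset.mpr he
  have k1 := cut_mem p hp {0, 1, 2, 3, 4, 5} (by decide) (by decide) [s(4, 6), s(1, 6)] (by decide)
  have k2 := cut_mem p hp {1} (by decide) (by decide) [s(0, 1), s(1, 2), s(1, 6)] (by decide)
  have k3 := cut_mem p hp {1, 2, 5} (by decide) (by decide)
    [s(0, 1), s(2, 3), s(4, 5), s(1, 6)] (by decide)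
  simp only [List.mem_cons, List.not_mem_nil, or_false, exists_eq_or_imp, exists_eq_left] at k1 k2 k3
  have := core2 (decide (s(0, 1) ∈ F)) (decide (s(0, 3) ∈ F)) (decide (s(1, 2) ∈ F))
    (decide (s(2, 3) ∈ F)) (decide (s(3, 4) ∈ F)) (decide (s(4, 5) ∈ F))
    (decide (s(2, 5) ∈ F)) (decide (s(4, 6) ∈ F)) (decide (s(1, 6) ∈ F))
  simp only [Bool.or_eq_true, decide_eq_true_eq, or_assoc] at this
  have := this k1 k2 k3
  rw [← exA_sum hF, ← exB_sum hF] at this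
  have h1 : ((6 : ℕ) : ℝ) ≤ ((∑ e ∈ F, exA e : ℕ) : ℝ) := Nat.cast_le.mpr this.1
  have h2 : ((3 : ℕ) : ℝ) ≤ ((∑ e ∈ F, exB e : ℕ) : ℝ) := Nat.cast_le.mpr this.2
  rw [ex_cost]
  push_cast at h1 h2 ⊢
  nlinarith

/-- Every Steiner forest other than `exF` costs at least `15x+8`. -/
theorem ex_forest {x : ℝ} (hx : 0 < x) (F : Finset (Sym2 (Fin 7)))
    (h : IsSteinerForest exG 0 5 1 6 F) : F = exF ∨ 15 * x + 8 ≤ cost (exC x) F := by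
  obtain ⟨hF, -, ⟨p, -, hp⟩, ⟨q, -, hq⟩⟩ := h
  rw [ex_edgeSet, Finset.coe_subset] at hF
  have k1 := cut_mem q hq {1, 2} (by decide) (by decide)
    [s(0, 1), s(2, 3), s(2, 5), s(1, 6)] (by decide)
  have k2 := cut_mem p hp {0} (by decide) (by decide) [s(0, 1), s(0, 3)] (by decide)
  have k3 := cut_mem p hp {0, 1, 2} (by decide) (by decide)
    [s(0, 3), s(2, 3), s(2, 5), s(1, 6)] (by decide)
  have k4 := cut_mem q hq {0, 1, 2, 3, 4, 5} (by decide) (by decide) [s(4, 6), s(1, 6)] (by decide)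
  have k5 := cut_mem p hp {0, 1, 2, 3} (by decide) (by decide)
    [s(3, 4), s(2, 5), s(1, 6)] (by decide)
  have k6 := cut_mem q hq {0, 1, 2, 3, 5} (by decide) (by decide)
    [s(3, 4), s(4, 5), s(1, 6)] (by decide)
  have k7 := cut_mem q hq {1, 2, 5} (by decide) (by decide)
    [s(0, 1), s(2, 3), s(4, 5), s(1, 6)] (by decide)
  have k8 := cut_mem p hp {0, 1, 2, 3, 6} (by decide) (by decide)
    [s(3, 4), s(2, 5), s(4, 6)] (by decide)
  have k9 := cut_mem q hq {1} (by decide) (by decide) [s(0, 1), s(1, 2), s(1, 6)] (by decide)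
  have k10 := cut_mem p hp {0, 1, 6} (by decide) (by decide)
    [s(0, 3), s(1, 2), s(4, 6)] (by decide)
  have k11 := cut_mem p hp {0, 1, 2, 3, 4, 6} (by decide) (by decide) [s(4, 5), s(2, 5)] (by decide)
  have k12 := cut_mem p hp {0, 1} (by decide) (by decide) [s(0, 3), s(1, 2), s(1, 6)] (by decide)
  have k13 := cut_mem q hq {0, 1, 2, 5} (by decide) (by decide)
    [s(0, 3), s(2, 3), s(4, 5), s(1, 6)] (by decide)
  have k14 := cut_mem p hp {0, 3, 4} (by decide) (by decide)
    [s(0, 1), s(2, 3), s(4, 5), s(4, 6)] (by decide)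
  simp only [List.mem_cons, List.not_mem_nil, or_false, exists_eq_or_imp, exists_eq_left]
    at k1 k2 k3 k4 k5 k6 k7 k8 k9 k10 k11 k12 k13 k14
  have := core3 (decide (s(0, 1) ∈ F)) (decide (s(0, 3) ∈ F)) (decide (s(1, 2) ∈ F))
    (decide (s(2, 3) ∈ F)) (decide (s(3, 4) ∈ F)) (decide (s(4, 5) ∈ F))
    (decide (s(2, 5) ∈ F)) (decide (s(4, 6) ∈ F)) (decide (s(1, 6) ∈ F))
  simp only [Bool.or_eq_true, decide_eq_true_eq, or_assoc] at this
  have := this k1 k2 k3 k4 k5 k6 k7 k8 k9 k10 k11 k12 k13 k14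
  rw [← exA_sum hF, ← exB_sum hF] at this
  rcases this with ⟨m0, m1, m2, m3, m4, m5, m6, m7, m8⟩ | this
  · left
    apply Finset.Subset.antisymm
    · intro e he
      have h2 := hF he
      simp only [exE, Finset.mem_insert, Finset.mem_singleton] at h2
      rcases h2 with rfl | rfl | rfl | rfl | rfl | rfl | rfl | rfl | rfl <;>
        first | contradiction | decide
    · intro e he
      simp only [exF, Finset.mem_insert, Finset.mem_singleton] at he
      rcases he with rfl | rfl | rfl | rfl | rfl | rfl <;> assumption
  · right
    have h1 : ((15 : ℕ) : ℝ) ≤ ((∑ e ∈ F, exA e : ℕ) : ℝ) := Nat.cast_le.mpr this.1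
    have h2 : ((8 : ℕ) : ℝ) ≤ ((∑ e ∈ F, exB e : ℕ) : ℝ) := Nat.cast_le.mpr this.2
    rw [ex_cost]
    push_cast at h1 h2 ⊢
    nlinarith

theorem exF_cost (x : ℝ) : cost (exC x) exF = 14 * x + 8 := by
  rw [ex_cost, show ∑ e ∈ exF, exA e = 14 by decide, show ∑ e ∈ exF, exB e = 8 by decide]
  norm_num

theorem exFalt_cost (x : ℝ) : cost (exC x) exFalt = 15 * x + 8 := by
  rw [ex_cost, show ∑ e ∈ exFalt, exA e = 15 by decide, show ∑ e ∈ exFalt, exB e = 8 by decide]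
  norm_num

/-! ### Explicit paths -/

open SimpleGraph in
/-- Path of player 1 in the optimum. -/
def W1 : Strat exG 0 5 :=
  ⟨.cons (ex_adj (b := 1) (by decide) (by decide)) <|
   .cons (ex_adj (b := 2) (by decide) (by decide)) <|
   .cons (ex_adj (b := 3) (by decide) (by decide)) <|
   .cons (ex_adj (b := 4) (by decide) (by decide)) <|
   .cons (ex_adj (b := 5) (by decide) (by decide)) .nil, by
    rw [Walk.isPath_def]; simp⟩

open SimpleGraph in
/-- Path of player 2 in the optimum. -/
def W2 : Strat exG 1 6 :=
  ⟨.cons (ex_adj (b := 2) (by decide) (by decide)) <|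
   .cons (ex_adj (b := 3) (by decide) (by decide)) <|
   .cons (ex_adj (b := 4) (by decide) (by decide)) <|
   .cons (ex_adj (b := 6) (by decide) (by decide)) .nil, by
    rw [Walk.isPath_def]; simp⟩

open SimpleGraph in
/-- First deviation of player 1. -/
def D1 : Strat exG 0 5 :=
  ⟨.cons (ex_adj (b := 3) (by decide) (by decide)) <|
   .cons (ex_adj (b := 4) (by decide) (by decide)) <|
   .cons (ex_adj (b := 5) (by decide) (by decide)) .nil, by
    rw [Walk.isPath_def]; simp⟩

open SimpleGraph in
/-- Second deviation of player 1. -/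
def D1b : Strat exG 0 5 :=
  ⟨.cons (ex_adj (b := 1) (by decide) (by decide)) <|
   .cons (ex_adj (b := 2) (by decide) (by decide)) <|
   .cons (ex_adj (b := 5) (by decide) (by decide)) .nil, by
    rw [Walk.isPath_def]; simp⟩

open SimpleGraph in
/-- Deviation of player 2. -/
def D2 : Strat exG 1 6 :=
  ⟨.cons (ex_adj (b := 6) (by decide) (by decide)) .nil, by
    rw [Walk.isPath_def]; simp⟩

theorem W1_edges : W1.1.edges = [s(0, 1), s(1, 2), s(2, 3), s(3, 4), s(4, 5)] := rfl
theorem W2_edges : W2.1.edges = [s(1, 2), s(2, 3), s(3, 4), s(4, 6)] := rfl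
theorem D1_edges : D1.1.edges = [s(0, 3), s(3, 4), s(4, 5)] := rfl
theorem D1b_edges : D1b.1.edges = [s(0, 1), s(1, 2), s(2, 5)] := rfl
theorem D2_edges : D2.1.edges = [s(1, 6)] := rfl

theorem exF_steiner : IsSteinerForest exG 0 5 1 6 exF := by
  refine ⟨?_, exF_acyclic, ⟨W1.1, W1.2, ?_⟩, ⟨W2.1, W2.2, ?_⟩⟩
  · rw [ex_edgeSet, Finset.coe_subset]; decide
  · rw [W1_edges]; decide
  · rw [W2_edges]; decide

theorem exFalt_steiner : IsSteinerForest exG 0 5 1 6 exFalt := by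
  refine ⟨?_, exFalt_acyclic, ⟨D1.1, D1.2, ?_⟩, ⟨D2.1, D2.2, ?_⟩⟩
  · rw [ex_edgeSet, Finset.coe_subset]; decide
  · rw [D1_edges]; decide
  · rw [D2_edges]; decide

theorem exF_optimal {x : ℝ} (hx : 0 < x) :
    IsOptimalSteinerForest exG 0 5 1 6 (exC x) exF := by
  refine ⟨exF_steiner, fun F' hF' => ?_⟩
  rcases ex_forest hx F' hF' with rfl | h
  · exact le_rfl
  · rw [exF_cost]; linarith

theorem share1 {x : ℝ} {Ξ : Protocol exG 0 5 1 6} (h : IsSeparable (exC x) Ξ)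
    (P : Strat exG 0 5) (Q : Strat exG 1 6) (e : Sym2 (Fin 7)) (hu : usedBy P Q e = {0}) :
    Ξ P Q 0 e = exC x e := by
  have := h.budget P Q e (by rw [hu]; simp)
  rwa [hu, Finset.sum_singleton] at this

theorem share2 {x : ℝ} {Ξ : Protocol exG 0 5 1 6} (h : IsSeparable (exC x) Ξ)
    (P : Strat exG 0 5) (Q : Strat exG 1 6) (e : Sym2 (Fin 7)) (hu : usedBy P Q e = {1}) :
    Ξ P Q 1 e = exC x e := by
  have := h.budget P Q e (by rw [hu]; simp)
  rwa [hu, Finset.sum_singleton] at this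

theorem share12 {x : ℝ} {Ξ : Protocol exG 0 5 1 6} (h : IsSeparable (exC x) Ξ)
    (P : Strat exG 0 5) (Q : Strat exG 1 6) (e : Sym2 (Fin 7)) (hu : usedBy P Q e = {0, 1}) :
    Ξ P Q 0 e + Ξ P Q 1 e = exC x e := by
  have := h.budget P Q e (by rw [hu]; simp)
  rwa [hu, Finset.sum_pair (by decide)] at this

theorem W1_cost (Ξ : Protocol exG 0 5 1 6) (Q) : cost₁ Ξ W1 Q =
    Ξ W1 Q 0 s(0, 1) + Ξ W1 Q 0 s(1, 2) + Ξ W1 Q 0 s(2, 3) + Ξ W1 Q 0 s(3, 4)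
      + Ξ W1 Q 0 s(4, 5) := by
  rw [cost₁, W1_edges, List.sum_toFinset _ (by decide)]
  simp; ring

theorem D1_cost (Ξ : Protocol exG 0 5 1 6) (Q) : cost₁ Ξ D1 Q =
    Ξ D1 Q 0 s(0, 3) + Ξ D1 Q 0 s(3, 4) + Ξ D1 Q 0 s(4, 5) := by
  rw [cost₁, D1_edges, List.sum_toFinset _ (by decide)]
  simp; ring

theorem D1b_cost (Ξ : Protocol exG 0 5 1 6) (Q) : cost₁ Ξ D1b Q =
    Ξ D1b Q 0 s(0, 1) + Ξ D1b Q 0 s(1, 2) + Ξ D1b Q 0 s(2, 5) := by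
  rw [cost₁, D1b_edges, List.sum_toFinset _ (by decide)]
  simp; ring

theorem W2_cost (Ξ : Protocol exG 0 5 1 6) (P) : cost₂ Ξ P W2 =
    Ξ P W2 1 s(1, 2) + Ξ P W2 1 s(2, 3) + Ξ P W2 1 s(3, 4) + Ξ P W2 1 s(4, 6) := by
  rw [cost₂, W2_edges, List.sum_toFinset _ (by decide)]
  simp; ring

theorem D2_cost (Ξ : Protocol exG 0 5 1 6) (P) : cost₂ Ξ P D2 = Ξ P D2 1 s(1, 6) := by
  rw [cost₂, D2_edges, List.sum_toFinset _ (by decide)]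
  simp

theorem exC_val (x : ℝ) (e : Sym2 (Fin 7)) (m n : ℕ) (h1 : exA e = m) (h2 : exB e = n) :
    exC x e = m * x + n := by rw [exC, h1, h2]

theorem exF_not_enforceable {x : ℝ} : ¬ Enforceable exG 0 5 1 6 (exC x) exF := by
  rintro ⟨P₁, P₂, -, -, h1, h2, Ξ, hs, hp1, hp2⟩
  obtain rfl := h1 W1 (by rw [W1_edges]; decide)
  obtain rfl := h2 W2 (by rw [W2_edges]; decide)
  have i1 := hp1 D1
  have i2 := hp1 D1b
  have i3 := hp2 D2
  rw [W1_cost, D1_cost] at i1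
  rw [W1_cost, D1b_cost] at i2
  rw [W2_cost, D2_cost] at i3
  rw [share1 hs W1 W2 s(0, 1) (by rw [usedBy, W1_edges, W2_edges]; decide),
    share1 hs W1 W2 s(4, 5) (by rw [usedBy, W1_edges, W2_edges]; decide)] at i1 i2
  rw [share1 hs D1 W2 s(0, 3) (by rw [usedBy, D1_edges, W2_edges]; decide),
    share1 hs D1 W2 s(4, 5) (by rw [usedBy, D1_edges, W2_edges]; decide),
    hs.separable D1 W2 W1 W2 s(3, 4)
      (by rw [usedBy, usedBy, D1_edges, W1_edges, W2_edges]; decide) 0] at i1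
  rw [share1 hs D1b W2 s(0, 1) (by rw [usedBy, D1b_edges, W2_edges]; decide),
    share1 hs D1b W2 s(2, 5) (by rw [usedBy, D1b_edges, W2_edges]; decide),
    hs.separable D1b W2 W1 W2 s(1, 2)
      (by rw [usedBy, usedBy, D1b_edges, W1_edges, W2_edges]; decide) 0] at i2
  rw [share2 hs W1 W2 s(4, 6) (by rw [usedBy, W1_edges, W2_edges]; decide),
    share2 hs W1 D2 s(1, 6) (by rw [usedBy, W1_edges, D2_edges]; decide)] at i3
  have b1 := share12 hs W1 W2 s(1, 2) (by rw [usedBy, W1_edges, W2_edges]; decide)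
  have b2 := share12 hs W1 W2 s(2, 3) (by rw [usedBy, W1_edges, W2_edges]; decide)
  have b3 := share12 hs W1 W2 s(3, 4) (by rw [usedBy, W1_edges, W2_edges]; decide)
  have n2 := hs.nonneg W1 W2 0 s(2, 3)
  rw [exC_val x s(0, 1) 3 2 (by decide) (by decide)] at i1 i2
  rw [exC_val x s(4, 5) 3 2 (by decide) (by decide)] at i1 i2
  rw [exC_val x s(0, 3) 4 2 (by decide) (by decide)] at i1
  rw [exC_val x s(2, 5) 4 2 (by decide) (by decide)] at i2
  rw [exC_val x s(4, 6) 3 1 (by decide) (by decide),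
    exC_val x s(1, 6) 6 3 (by decide) (by decide)] at i3
  rw [exC_val x s(1, 2) 2 1 (by decide) (by decide)] at b1
  rw [exC_val x s(2, 3) 1 1 (by decide) (by decide)] at b2
  rw [exC_val x s(3, 4) 2 1 (by decide) (by decide)] at b3
  push_cast at i1 i2 i3 b1 b2 b3
  linarith

open Classical in
/-- The shares of the protocol enforcing `exFalt`. -/
noncomputable def exShare (x : ℝ) (U : Finset (Fin 2)) (i : Fin 2) (e : Sym2 (Fin 7)) : ℝ :=
  if U = {i} then exC x e
  else if U = {0, 1} then
    (if e = s(1, 6) then (if i = 0 then exC x e else 0) else (if i = 1 then exC x e else 0))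
  else 0

/-- The protocol enforcing `exFalt`. -/
noncomputable def exΞ (x : ℝ) : Protocol exG 0 5 1 6 :=
  fun P Q i e => exShare x (usedBy P Q e) i e

theorem exΞ_pne {x : ℝ} (hx : 0 < x) : IsPNE (exΞ x) D1 D2 := by
  have c1 : ∀ Q₁, cost₁ (exΞ x) Q₁ D2 = cost (exC x) Q₁.1.edges.toFinset := by
    intro Q
    refine Finset.sum_congr rfl fun e he => ?_
    have he' : e ∈ Q.1.edges := List.mem_toFinset.mp he
    unfold exΞ usedBy
    rw [D2_edges, if_pos he']
    by_cases h : e = s(1, 6)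
    · subst h
      simp [exShare]
    · rw [if_neg (by simpa using h)]
      simp [exShare]
  have c2 : ∀ Q₂, cost₂ (exΞ x) D1 Q₂ = cost (exC x) Q₂.1.edges.toFinset := by
    intro Q
    refine Finset.sum_congr rfl fun e he => ?_
    have he' : e ∈ Q.1.edges := List.mem_toFinset.mp he
    unfold exΞ usedBy
    rw [D1_edges, if_pos he']
    by_cases h : e ∈ [s(0, 3), s(3, 4), s(4, 5)]
    · rw [if_pos h]
      have h2 : e ≠ s(1, 6) := by rintro rfl; revert h; decide
      rw [show ({0} ∪ {1} : Finset (Fin 2)) = {0, 1} from rfl]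
      unfold exShare
      rw [if_neg (by decide), if_pos rfl, if_neg h2, if_pos rfl]
    · rw [if_neg h]
      simp [exShare]
  have e1 : cost (exC x) D1.1.edges.toFinset = 9 * x + 5 := by
    rw [ex_cost, D1_edges]
    rw [show ∑ e ∈ [s(0, 3), s(3, 4), s(4, 5)].toFinset, exA e = 9 by decide,
      show ∑ e ∈ [s(0, 3), s(3, 4), s(4, 5)].toFinset, exB e = 5 by decide]
    norm_num
  have e2 : cost (exC x) D2.1.edges.toFinset = 6 * x + 3 := by
    rw [ex_cost, D2_edges]
    rw [show ∑ e ∈ [s(1, 6)].toFinset, exA e = 6 by decide,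
      show ∑ e ∈ [s(1, 6)].toFinset, exB e = 3 by decide]
    norm_num
  constructor
  · intro Q
    rw [c1, c1, e1]
    exact ex_dist1 hx Q.1
  · intro Q
    rw [c2, c2, e2]
    exact ex_dist2 hx Q.1

theorem exΞ_separable {x : ℝ} (hx : 0 < x) : IsSeparable (exC x) (exΞ x) where
  nonneg P Q i e := by
    have := exC_nonneg hx e
    unfold exΞ exShare
    split_ifs <;> first | exact this | exact le_rfl
  budget P Q e h := by
    unfold exΞ
    generalize usedBy P Q e = U at h
    have hU : U = {0} ∨ U = {1} ∨ U = {0, 1} := by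
      revert h; revert U; decide
    rcases hU with rfl | rfl | rfl
    · simp [exShare]
    · simp [exShare]
    · rw [Finset.sum_pair (by decide)]
      unfold exShare
      have h0 : ({0, 1} : Finset (Fin 2)) ≠ {0} := by decide
      have h1 : ({0, 1} : Finset (Fin 2)) ≠ {1} := by decide
      rw [if_neg h0, if_neg h1]
      by_cases he : e = s(1, 6) <;> simp [he]
  stable := ⟨D1, D2, exΞ_pne hx⟩
  separable P₁ P₂ Q₁ Q₂ e h i := by
    unfold exΞ
    rw [h]

theorem exFalt_enforceable {x : ℝ} (hx : 0 < x) : Enforceable exG 0 5 1 6 (exC x) exFalt := by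
  have h1 : ∀ e ∈ D1.1.edges, e ∈ exFalt := by rw [D1_edges]; decide
  have h2 : ∀ e ∈ D2.1.edges, e ∈ exFalt := by rw [D2_edges]; decide
  exact ⟨D1, D2, h1, h2, fun Q hQ => path_unique_in exFalt_acyclic Q D1 hQ h1,
    fun Q hQ => path_unique_in exFalt_acyclic Q D2 hQ h2, exΞ x, exΞ_separable hx, exΞ_pne hx⟩

/-- The price of stability for two-player undirected network
design games with separable cost sharing protocols is at least `15/14`: for
every `x > 0` there is an instance whose unique optimal Steiner forest has cost
`14x + 8` and is not enforceable, while some enforceable Steiner forest has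
cost `15x + 8`; consequently, for every `ε > 0` there is an instance in which
every enforceable Steiner forest costs at least `(15/14 - ε)` times the optimal
cost. -/
theorem price_of_stability_lower_bound :
    (∀ x : ℝ, 0 < x →
      ∃ (N : ℕ) (G : SimpleGraph (Fin N)) (c : Sym2 (Fin N) → ℝ) (s₁ t₁ s₂ t₂ : Fin N),
        (∀ e, 0 ≤ c e) ∧
        ∃ F, IsOptimalSteinerForest G s₁ t₁ s₂ t₂ c F ∧
          (∀ F', IsOptimalSteinerForest G s₁ t₁ s₂ t₂ c F' → F' = F) ∧
          cost c F = 14 * x + 8 ∧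
          ¬ Enforceable G s₁ t₁ s₂ t₂ c F ∧
          ∃ F', IsSteinerForest G s₁ t₁ s₂ t₂ F' ∧ Enforceable G s₁ t₁ s₂ t₂ c F' ∧
            cost c F' = 15 * x + 8) ∧
    (∀ ε : ℝ, 0 < ε →
      ∃ (N : ℕ) (G : SimpleGraph (Fin N)) (c : Sym2 (Fin N) → ℝ) (s₁ t₁ s₂ t₂ : Fin N),
        (∀ e, 0 ≤ c e) ∧
        ∃ F, IsOptimalSteinerForest G s₁ t₁ s₂ t₂ c F ∧
          ∀ F', IsSteinerForest G s₁ t₁ s₂ t₂ F' → Enforceable G s₁ t₁ s₂ t₂ c F' →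
            (15 / 14 - ε) * cost c F ≤ cost c F') := by
  constructor
  · intro x hx
    refine ⟨7, exG, exC x, 0, 5, 1, 6, exC_nonneg hx, exF, exF_optimal hx, ?_, exF_cost x,
      exF_not_enforceable, exFalt, exFalt_steiner, exFalt_enforceable hx, exFalt_cost x⟩
    intro F' hF'
    rcases ex_forest hx F' hF'.1 with h | h
    · exact h
    · have := hF'.2 exF exF_steiner
      rw [exF_cost] at this
      linarith
  · intro ε hε
    have hx : 0 < 1 / ε := by positivity
    refine ⟨7, exG, exC (1 / ε), 0, 5, 1, 6, exC_nonneg hx, exF, exF_optimal hx, ?_⟩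
    intro F' hF' hE
    rcases ex_forest hx F' hF' with h | h
    · exact absurd (h ▸ hE) exF_not_enforceable
    · refine le_trans ?_ h
      rw [exF_cost]
      have : ε * (1 / ε) = 1 := by field_simp
      nlinarith

end NDG
end
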